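/- arXiv:1212.0631 — 4 statements merged into one kernel-verified Lean document; each statement's English description precedes it below -/
import Mathlib

section
/- Let n ≥ 2 be an integer, T > 0, and m ≥ 0 a real number. Then ∫_{I[p,q]} (x⁰)² · τ(x,q)^m dx = f₃(m) · T² · ∫_{I[p,q]} τ(x,q)^m dx, where f₃(m) = ( 8n + m(m+2)(m+n+2) ) / ( 4(m+n+2)(2n+m)(2n+m+2) ). -/
open MeasureTheory

/-- A point of `n`-dimensional Minkowski space: a time coordinate in `ℝ`
and a spatial part in `ℝ^{n-1}` (with the Euclidean norm). -/
abbrev MinkPt (n : ℕ) := ℝ × EuclideanSpace ℝ (Fin (n - 1))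

/-- The Minkowski causal order: `x ⪯ y` iff `y⁰ - x⁰ ≥ ‖y⃗ - x⃗‖`. -/
def causalLE {n : ℕ} (x y : MinkPt n) : Prop := ‖y.2 - x.2‖ ≤ y.1 - x.1

/-- The bottom tip `p = (-T/2, 0)` of the causal diamond. -/
noncomputable def pDiam (n : ℕ) (T : ℝ) : MinkPt n := (-(T / 2), 0)

/-- The top tip `q = (T/2, 0)` of the causal diamond. -/
noncomputable def qDiam (n : ℕ) (T : ℝ) : MinkPt n := (T / 2, 0)

/-- The Alexandrov interval (causal diamond) `I[p,q] = {x : p ⪯ x ⪯ q}`. -/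
def diamond (n : ℕ) (T : ℝ) : Set (MinkPt n) :=
  {x | causalLE (pDiam n T) x ∧ causalLE x (qDiam n T)}

/-- The surface area `A_{d} = 2π^{(d+1)/2}/Γ((d+1)/2)` of the unit sphere `S^{d} ⊂ ℝ^{d+1}`;
here we take `d = n - 2`, so `A_{n-2} = 2π^{(n-1)/2}/Γ((n-1)/2)`. -/
noncomputable def sphereArea (n : ℕ) : ℝ :=
  2 * Real.pi ^ (((n : ℝ) - 1) / 2) / Real.Gamma (((n : ℝ) - 1) / 2)


/-- The proper time `τ(x,y) = √((y⁰-x⁰)² - ‖y⃗-x⃗‖²)` between causally related points. -/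
noncomputable def tau {n : ℕ} (x y : MinkPt n) : ℝ :=
  Real.sqrt ((y.1 - x.1) ^ 2 - ‖y.2 - x.2‖ ^ 2)

section TruncatedCone

variable {E : Type*} [NormedAddCommGroup E]

/-- The causal diamond in coordinates centred at its top tip, with time reversed. -/
def truncatedCone (E : Type*) [NormedAddCommGroup E] (T : ℝ) : Set (ℝ × E) :=
  {x | ‖x.2‖ ≤ x.1 ∧ x.1 + ‖x.2‖ ≤ T}

theorem isClosed_truncatedCone (T : ℝ) : IsClosed (truncatedCone E T) :=
  (isClosed_le (f := fun x : ℝ × E => ‖x.2‖) (g := fun x => x.1) (by fun_prop)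
    (by fun_prop)).inter
  (isClosed_le (f := fun x : ℝ × E => x.1 + ‖x.2‖) (g := fun _ => T) (by fun_prop) (by fun_prop))

theorem truncatedCone_subset (T : ℝ) :
    truncatedCone E T ⊆ Set.Icc 0 T ×ˢ Metric.closedBall (0 : E) T := by
  rintro ⟨s, y⟩ ⟨h₁, h₂⟩
  have := norm_nonneg y
  simp only [Set.mem_prod, Set.mem_Icc, mem_closedBall_zero_iff]
  dsimp only at h₁ h₂
  refine ⟨⟨?_, ?_⟩, ?_⟩ <;> linarith

theorem isCompact_truncatedCone [NormedSpace ℝ E] [FiniteDimensional ℝ E] (T : ℝ) :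
    IsCompact (truncatedCone E T) :=
  have := FiniteDimensional.proper ℝ E
  (isCompact_Icc.prod (isCompact_closedBall _ _)).of_isClosed_subset (isClosed_truncatedCone T)
    (truncatedCone_subset T)

variable [NormedSpace ℝ E] [FiniteDimensional ℝ E] [MeasurableSpace E] [BorelSpace E]

theorem integrableOn_truncatedCone (μ : Measure E) [μ.IsAddHaarMeasure] (T m : ℝ) (hm : 0 ≤ m)
    (k : ℕ) :
    IntegrableOn (fun x : ℝ × E => x.1 ^ k * Real.sqrt (x.1 ^ 2 - ‖x.2‖ ^ 2) ^ m)
      (truncatedCone E T) (volume.prod μ) := by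
  have := FiniteDimensional.proper ℝ E
  refine ContinuousOn.integrableOn_compact (isCompact_truncatedCone T) ?_
  exact Continuous.continuousOn (by fun_prop (disch := assumption))

theorem integral_truncatedCone (μ : Measure E) [μ.IsAddHaarMeasure] (T m : ℝ) (hT : 0 < T)
    (hm : 0 ≤ m) (k : ℕ) {N : ℝ} (hN : N = Module.finrank ℝ E + k + m + 1) :
    ∫ x in truncatedCone E T, x.1 ^ k * Real.sqrt (x.1 ^ 2 - ‖x.2‖ ^ 2) ^ m ∂(volume.prod μ) =
      T ^ N / N * ∫ z in Metric.closedBall (0 : E) 1,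
        Real.sqrt (1 - ‖z‖ ^ 2) ^ m * (1 + ‖z‖) ^ (-N) ∂μ := by
  have := FiniteDimensional.proper ℝ E
  have hNp : 0 ≤ N - 1 := by
    have : (0 : ℝ) ≤ Module.finrank ℝ E + k := by positivity
    linarith
  set D : Set (ℝ × E) := {x | 0 < x.1 ∧ ‖x.2‖ ≤ 1 ∧ x.1 * (1 + ‖x.2‖) ≤ T} with hD
  have hDm : MeasurableSet D := by
    have h₁ : MeasurableSet {x : ℝ × E | 0 < x.1} := measurableSet_lt (by fun_prop) (by fun_prop)
    have h₂ : MeasurableSet {x : ℝ × E | ‖x.2‖ ≤ 1} :=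
      measurableSet_le (by fun_prop) (by fun_prop)
    have h₃ : MeasurableSet {x : ℝ × E | x.1 * (1 + ‖x.2‖) ≤ T} :=
      measurableSet_le (by fun_prop) (by fun_prop)
    exact h₁.inter (h₂.inter h₃)
  set g : ℝ × E → ℝ := D.indicator fun x => x.1 ^ (N - 1) * Real.sqrt (1 - ‖x.2‖ ^ 2) ^ m with hg
  have hgint : Integrable g (volume.prod μ) := by
    rw [hg, integrable_indicator_iff hDm]
    refine IntegrableOn.mono_set (t := Set.Icc 0 T ×ˢ Metric.closedBall (0 : E) 1) ?_ ?_
    · refine ContinuousOn.integrableOn_compact (isCompact_Icc.prod (isCompact_closedBall _ _)) ?_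
      exact Continuous.continuousOn (by fun_prop (disch := assumption))
    · rintro ⟨s, z⟩ ⟨h₁, h₂, h₃⟩
      dsimp only at h₁ h₂ h₃
      have := mul_nonneg h₁.le (norm_nonneg z)
      simp only [Set.mem_prod, Set.mem_Icc, mem_closedBall_zero_iff]
      exact ⟨⟨h₁.le, by linarith⟩, h₂⟩
  have hCm := (isClosed_truncatedCone (E := E) T).measurableSet
  rw [← integral_indicator hCm,
    integral_prod _ ((integrable_indicator_iff hCm).2 (integrableOn_truncatedCone μ T m hm k))]
  have hscale : ∀ᵐ s : ℝ, ∫ y, (truncatedCone E T).indicator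
      (fun x : ℝ × E => x.1 ^ k * Real.sqrt (x.1 ^ 2 - ‖x.2‖ ^ 2) ^ m) (s, y) ∂μ =
      ∫ z, g (s, z) ∂μ := by
    filter_upwards [Measure.ae_ne volume (0 : ℝ)] with s hs
    rcases lt_or_gt_of_ne hs with hs | hs
    · congr 1
      ext y
      rw [Set.indicator_of_notMem, hg, Set.indicator_of_notMem]
      · exact fun h => hs.not_gt h.1
      · exact fun h => hs.not_ge ((norm_nonneg y).trans h.1)
    · have h := Measure.integral_comp_smul_of_nonneg μ (fun y => (truncatedCone E T).indicator
        (fun x : ℝ × E => x.1 ^ k * Real.sqrt (x.1 ^ 2 - ‖x.2‖ ^ 2) ^ m) (s, y)) s (hR := hs.le)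
      rw [smul_eq_mul, eq_comm, inv_mul_eq_iff_eq_mul₀ (by positivity)] at h
      rw [h, ← integral_const_mul]
      congr 1
      ext z
      have hmem : (s, s • z) ∈ truncatedCone E T ↔ (s, z) ∈ D := by
        simp only [truncatedCone, hD, Set.mem_ofPred_eq, norm_smul, Real.norm_of_nonneg hs.le]
        rw [mul_le_iff_le_one_right hs]
        constructor
        · exact fun h => ⟨hs, h.1, by linarith [h.2]⟩
        · exact fun h => ⟨h.2.1, by linarith [h.2.2]⟩
      by_cases hz : (s, z) ∈ D
      · rw [Set.indicator_of_mem (hmem.2 hz), hg, Set.indicator_of_mem hz]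
        simp only [norm_smul, Real.norm_of_nonneg hs.le]
        rw [show s ^ 2 - (s * ‖z‖) ^ 2 = s ^ 2 * (1 - ‖z‖ ^ 2) by ring,
          Real.sqrt_mul (sq_nonneg s), Real.sqrt_sq hs.le,
          Real.mul_rpow hs.le (Real.sqrt_nonneg _),
          show N - 1 = (Module.finrank ℝ E : ℝ) + k + m by rw [hN]; ring,
          Real.rpow_add hs, Real.rpow_add hs, Real.rpow_natCast, Real.rpow_natCast]
        ring
      · rw [Set.indicator_of_notMem (fun h => hz (hmem.1 h)), hg, Set.indicator_of_notMem hz,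
          mul_zero]
  rw [integral_congr_ae hscale,
    integral_integral_swap (f := fun s z => g (s, z)) hgint, ← integral_const_mul,
    ← integral_indicator Metric.isClosed_closedBall.measurableSet]
  congr 1
  ext z
  have hz0 : 0 < 1 + ‖z‖ := by positivity
  by_cases hz : ‖z‖ ≤ 1
  · rw [Set.indicator_of_mem (by simpa using hz)]
    have hgz : (fun s => g (s, z)) = (Set.Ioc 0 (T / (1 + ‖z‖))).indicator
        fun s => s ^ (N - 1) * Real.sqrt (1 - ‖z‖ ^ 2) ^ m := by
      ext s
      simp only [hg, hD, Set.indicator, Set.mem_ofPred_eq, Set.mem_Ioc, le_div_iff₀ hz0, hz,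
        true_and]
    rw [hgz, integral_indicator measurableSet_Ioc,
      ← intervalIntegral.integral_of_le (by positivity), intervalIntegral.integral_mul_const,
      integral_rpow (Or.inl (by linarith)), sub_add_cancel, Real.zero_rpow (by linarith),
      Real.div_rpow hT.le hz0.le, Real.rpow_neg hz0.le]
    ring
  · rw [Set.indicator_of_notMem (by simpa using hz)]
    have hgz : (fun s => g (s, z)) = fun _ => 0 := by
      ext s
      exact Set.indicator_of_notMem (fun h => hz h.2.1) _
    rw [hgz, integral_zero]

end TruncatedCone

/-- The radial integrals `∫₀¹ r^d (1 - r²)^{m/2} (1 + r)^{-N} dr`. -/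
noncomputable def radialIntegral (d : ℕ) (m N : ℝ) : ℝ :=
  ∫ r in (0 : ℝ)..1, r ^ d * (Real.sqrt (1 - r ^ 2) ^ m * (1 + r) ^ (-N))

theorem continuousOn_radial (d : ℕ) {m : ℝ} (hm : 0 ≤ m) (N : ℝ) :
    ContinuousOn (fun r : ℝ => r ^ d * (Real.sqrt (1 - r ^ 2) ^ m * (1 + r) ^ (-N)))
      (Set.Icc 0 1) := by
  refine (Continuous.continuousOn (by fun_prop)).mul
    ((Continuous.continuousOn (by fun_prop (disch := assumption))).mul ?_)
  refine ContinuousOn.rpow_const (by fun_prop) fun r hr => Or.inl ?_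
  linarith [hr.1]

theorem intervalIntegrable_radial (d : ℕ) {m : ℝ} (hm : 0 ≤ m) (N : ℝ) :
    IntervalIntegrable (fun r : ℝ => r ^ d * (Real.sqrt (1 - r ^ 2) ^ m * (1 + r) ^ (-N)))
      volume 0 1 := by
  apply ContinuousOn.intervalIntegrable
  rw [Set.uIcc_of_le zero_le_one]
  exact continuousOn_radial d hm N

/-- Integration by parts: the derivative of `r^{d+1} (1 - r²)^{m/2+1} (1 + r)^{-N}`
integrates to zero over `[0, 1]`. -/
theorem radialIntegral_recurrence (d : ℕ) {m : ℝ} (hm : 0 ≤ m) {N c : ℝ}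
    (hc : c = N - d - m - 3) :
    (d + 1 + N + c) * radialIntegral d m N - (N + 2 * c) * radialIntegral d m (N - 1) +
      c * radialIntegral d m (N - 2) = 0 := by
  have h := intervalIntegral.integral_eq_sub_of_hasDerivAt_of_le (a := 0) (b := 1) zero_le_one
    (f := fun r : ℝ => r ^ (d + 1) * ((1 - r ^ 2) ^ (m / 2 + 1) * (1 + r) ^ (-N)))
    (f' := fun r : ℝ =>
      (d + 1 + N + c) * (r ^ d * (Real.sqrt (1 - r ^ 2) ^ m * (1 + r) ^ (-N))) -
      (N + 2 * c) * (r ^ d * (Real.sqrt (1 - r ^ 2) ^ m * (1 + r) ^ (-(N - 1)))) +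
      c * (r ^ d * (Real.sqrt (1 - r ^ 2) ^ m * (1 + r) ^ (-(N - 2))))) ?_ ?_ ?_
  · rw [intervalIntegral.integral_add, intervalIntegral.integral_sub,
      intervalIntegral.integral_const_mul, intervalIntegral.integral_const_mul,
      intervalIntegral.integral_const_mul] at h
    · refine h.trans ?_
      have : m / 2 + 1 ≠ 0 := by positivity
      simp [Real.zero_rpow this]
    · exact (intervalIntegrable_radial d hm _).const_mul _
    · exact (intervalIntegrable_radial d hm _).const_mul _
    · exact ((intervalIntegrable_radial d hm _).const_mul _).sub
        ((intervalIntegrable_radial d hm _).const_mul _)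
    · exact (intervalIntegrable_radial d hm _).const_mul _
  · refine (Continuous.continuousOn (by fun_prop)).mul
      ((ContinuousOn.rpow_const (by fun_prop) fun r _ => Or.inr (by positivity)).mul
        (ContinuousOn.rpow_const (by fun_prop) fun r hr => Or.inl ?_))
    linarith [hr.1]
  · intro r hr
    have h₁ : 0 < 1 - r ^ 2 := by nlinarith [hr.1, hr.2]
    have h₂ : 0 < 1 + r := by linarith [hr.1]
    have hd₁ : HasDerivAt (fun r : ℝ => 1 - r ^ 2) (-(2 * r)) r := by
      simpa using (hasDerivAt_pow 2 r).const_sub 1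
    have hd₂ : HasDerivAt (fun r : ℝ => 1 + r) 1 r := (hasDerivAt_id r).const_add 1
    refine ((hasDerivAt_pow (d + 1) r).mul
      ((hd₁.rpow_const (p := m / 2 + 1) (Or.inl h₁.ne')).mul
        (hd₂.rpow_const (p := -N) (Or.inl h₂.ne')))).congr_deriv ?_
    simp only [Pi.mul_apply, Real.sqrt_eq_rpow, ← Real.rpow_mul h₁.le, one_div_mul_eq_div,
      add_sub_cancel_right, Real.rpow_add_one h₁.ne', Real.rpow_sub_one h₂.ne',
      show -(N - 1) = -N + 1 by ring, show -(N - 2) = -N + 1 + 1 by ring, Real.rpow_add_one h₂.ne', hc]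
    push_cast
    field_simp
    ring
  · exact (((intervalIntegrable_radial d hm _).const_mul _).sub
      ((intervalIntegrable_radial d hm _).const_mul _)).add
      ((intervalIntegrable_radial d hm _).const_mul _)

theorem setIntegral_closedBall_radial {E : Type*} [NormedAddCommGroup E] [NormedSpace ℝ E]
    [FiniteDimensional ℝ E] [MeasurableSpace E] [BorelSpace E] [Nontrivial E]
    (μ : Measure E) [μ.IsAddHaarMeasure] (m N : ℝ) :
    ∫ z in Metric.closedBall (0 : E) 1, Real.sqrt (1 - ‖z‖ ^ 2) ^ m * (1 + ‖z‖) ^ (-N) ∂μ =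
      Module.finrank ℝ E * μ.real (Metric.ball 0 1) *
        radialIntegral (Module.finrank ℝ E - 1) m N := by
  rw [← integral_indicator Metric.isClosed_closedBall.measurableSet]
  have h := integral_fun_norm_addHaar μ ((Set.Iic (1 : ℝ)).indicator fun r =>
    Real.sqrt (1 - r ^ 2) ^ m * (1 + r) ^ (-N))
  have h' : (Metric.closedBall (0 : E) 1).indicator
      (fun z => Real.sqrt (1 - ‖z‖ ^ 2) ^ m * (1 + ‖z‖) ^ (-N)) =
      fun z => (Set.Iic (1 : ℝ)).indicator
        (fun r => Real.sqrt (1 - r ^ 2) ^ m * (1 + r) ^ (-N)) ‖z‖ := by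
    ext z
    simp [Set.indicator]
  rw [h', h, nsmul_eq_mul, smul_eq_mul, radialIntegral,
    intervalIntegral.integral_of_le zero_le_one, mul_assoc]
  congr 2
  rw [← Set.Ioi_inter_Iic, ← setIntegral_indicator measurableSet_Iic]
  congr 1
  ext r
  by_cases hr : r ≤ 1 <;> simp [Set.indicator, hr]

theorem setIntegral_diamond (n : ℕ) (T : ℝ) (f : MinkPt n → ℝ) :
    ∫ x in diamond n T, f (T / 2 - x.1, x.2) =
      ∫ x in truncatedCone (EuclideanSpace ℝ (Fin (n - 1))) T, f x := by
  have hmp : MeasurePreserving ((MeasurableEquiv.subLeft (T / 2)).prodCongr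
      (MeasurableEquiv.refl (EuclideanSpace ℝ (Fin (n - 1))))) volume volume :=
    (Measure.measurePreserving_sub_left volume (T / 2)).prod (MeasurePreserving.id _)
  have h := hmp.setIntegral_preimage_emb (MeasurableEquiv.measurableEmbedding _) f
    (truncatedCone (EuclideanSpace ℝ (Fin (n - 1))) T)
  rw [← h]
  refine setIntegral_congr_set (Filter.Eventually.of_forall fun x => propext ?_)
  change (‖x.2 - 0‖ ≤ x.1 - -(T / 2) ∧ ‖0 - x.2‖ ≤ T / 2 - x.1) ↔
    (‖x.2‖ ≤ T / 2 - x.1 ∧ T / 2 - x.1 + ‖x.2‖ ≤ T)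
  rw [sub_zero, zero_sub, norm_neg]
  constructor <;> rintro ⟨h₁, h₂⟩ <;> constructor <;> linarith

/-- `∫_{I[p,q]} (x⁰)² τ(x,q)^m dx = f₃(m) · T² · ∫_{I[p,q]} τ(x,q)^m dx`, where
`f₃(m) = (8n + m(m+2)(m+n+2))/(4(m+n+2)(2n+m)(2n+m+2))`. -/
theorem stmt5 (n : ℕ) (hn : 2 ≤ n) (T m : ℝ) (hT : 0 < T) (hm : 0 ≤ m) :
    (∫ x in diamond n T, x.1 ^ 2 * tau x (qDiam n T) ^ m) =
      ((8 * (n : ℝ) + m * (m + 2) * (m + (n : ℝ) + 2)) /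
          (4 * (m + (n : ℝ) + 2) * (2 * (n : ℝ) + m) * (2 * (n : ℝ) + m + 2))) *
        T ^ 2 * ∫ x in diamond n T, tau x (qDiam n T) ^ m := by
  have : Nonempty (Fin (n - 1)) := ⟨⟨0, by omega⟩⟩
  have hn' : (2 : ℝ) ≤ n := by exact_mod_cast hn
  have hdim : Module.finrank ℝ (EuclideanSpace ℝ (Fin (n - 1))) = n - 1 := by simp
  have hdimR : ((n - 1 : ℕ) : ℝ) = n - 1 := by rw [Nat.cast_sub (by omega), Nat.cast_one]
  have hd : ((n - 1 - 1 : ℕ) : ℝ) = n - 2 := by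
    rw [Nat.cast_sub (by omega), hdimR]; push_cast; ring
  set C := truncatedCone (EuclideanSpace ℝ (Fin (n - 1))) T
  set w : ℕ → MinkPt n → ℝ := fun k x => x.1 ^ k * Real.sqrt (x.1 ^ 2 - ‖x.2‖ ^ 2) ^ m with hw
  have hint (k : ℕ) : IntegrableOn (w k) C := integrableOn_truncatedCone volume T m hm k
  have hτ (x : MinkPt n) : tau x (qDiam n T) ^ m = w 0 (T / 2 - x.1, x.2) := by
    simp [hw, tau, qDiam]
  have h₀ : ∫ x in diamond n T, tau x (qDiam n T) ^ m = ∫ x in C, w 0 x := by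
    simp_rw [hτ]
    exact setIntegral_diamond n T (w 0)
  have h₂ : ∫ x in diamond n T, x.1 ^ 2 * tau x (qDiam n T) ^ m =
      T ^ 2 / 4 * (∫ x in C, w 0 x) - T * (∫ x in C, w 1 x) + ∫ x in C, w 2 x := by
    rw [← integral_const_mul, ← integral_const_mul,
      ← integral_sub ((hint 0).const_mul _) ((hint 1).const_mul _),
      ← integral_add (f := fun x => T ^ 2 / 4 * w 0 x - T * w 1 x)
        (((hint 0).const_mul _).sub ((hint 1).const_mul _)) (hint 2),
      ← setIntegral_diamond n T]
    congr 1
    ext x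
    rw [hτ]
    simp only [hw]
    ring
  have hmoment (k : ℕ) := integral_truncatedCone (E := EuclideanSpace ℝ (Fin (n - 1))) volume T m
    hT hm k (N := n + m + k) (by rw [hdim, hdimR]; ring)
  simp_rw [setIntegral_closedBall_radial, hdim] at hmoment
  have e₀ := hmoment 0
  have e₁ := hmoment 1
  have e₂ := hmoment 2
  have r₁ := radialIntegral_recurrence (n - 1 - 1) hm (N := n + m + 1) (c := 0) (by rw [hd]; ring)
  have r₂ := radialIntegral_recurrence (n - 1 - 1) hm (N := n + m + 2) (c := 1) (by rw [hd]; ring)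
  rw [h₂, h₀]
  simp only [hw]
  rw [Measure.volume_eq_prod, e₀, e₁, e₂]
  push_cast
  rw [hd] at r₁ r₂
  rw [show (n : ℝ) + m + 1 - 1 = n + m by ring] at r₁
  rw [show (n : ℝ) + m + 2 - 1 = n + m + 1 by ring, show (n : ℝ) + m + 2 - 2 = n + m by ring] at r₂
  rw [add_zero, Real.rpow_add hT _ 1, Real.rpow_add hT _ 2, Real.rpow_one, Real.rpow_two]
  set J₀ := radialIntegral (n - 1 - 1) m (n + m)
  set J₁ := radialIntegral (n - 1 - 1) m (n + m + 1)
  set J₂ := radialIntegral (n - 1 - 1) m (n + m + 2)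
  have hJ₁ : J₁ = (n + m + 1) / (2 * n + m) * J₀ := by
    field_simp
    linear_combination r₁
  have hJ₂ : J₂ = ((n + m + 4) * J₁ - J₀) / (2 * n + m + 2) := by
    field_simp
    linear_combination r₂
  rw [hJ₂, hJ₁]
  field_simp
  ring
end

section
/- Let n ≥ 2 be an integer, T > 0, and m ≥ 0 a real number. Then ∫_{I[p,q]} x⁰ · τ(x,q)^m dx = f̃₄(m) · T · ∫_{I[p,q]} τ(x,q)^m dx, where f̃₄(m) = (1/2)·( 1 - (m+n)/(m+n+1) - ( (m/2+1)(m+n) ) / ( (m+n+1)(m/2+n) ) ). In particular f̃₄(0) = 0. -/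
open MeasureTheory

/-- The half-diamond `{(t, r) : 0 < r, r ≤ t + T/2, r ≤ T/2 - t}`: the time coordinate and the
spatial radius of the points of the diamond off its axis. -/
def halfDiamond (T : ℝ) : Set (ℝ × ℝ) :=
  {z | 0 < z.2 ∧ z.2 ≤ z.1 + T / 2 ∧ z.2 ≤ T / 2 - z.1}

lemma measurableSet_halfDiamond (T : ℝ) : MeasurableSet (halfDiamond T) := by
  refine (measurableSet_lt measurable_const measurable_snd).inter
    ((measurableSet_le measurable_snd ?_).inter (measurableSet_le measurable_snd ?_)) <;> fun_prop

lemma Continuous.integrableOn_halfDiamond {T : ℝ} {f : ℝ × ℝ → ℝ} (hf : Continuous f) :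
    IntegrableOn f (halfDiamond T) := by
  refine (hf.continuousOn.integrableOn_compact
    (isCompact_Icc (a := (-(T / 2), (0 : ℝ))) (b := (T / 2, T / 2)))).mono_set ?_
  rintro ⟨t, r⟩ ⟨h0, h1, h2⟩
  simp only at h0 h1 h2
  refine ⟨⟨?_, ?_⟩, ?_, ?_⟩ <;> simp only <;> linarith

lemma mem_diamond_iff {n : ℕ} {T : ℝ} {x : MinkPt n} :
    x ∈ diamond n T ↔ ‖x.2‖ ≤ x.1 + T / 2 ∧ ‖x.2‖ ≤ T / 2 - x.1 := by
  simp [diamond, causalLE, pDiam, qDiam]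

lemma isCompact_diamond (n : ℕ) (T : ℝ) : IsCompact (diamond n T) := by
  refine ((isCompact_Icc (a := -(T / 2)) (b := T / 2)).prod
    (isCompact_closedBall (0 : EuclideanSpace ℝ (Fin (n - 1))) (T / 2))).of_isClosed_subset ?_ ?_
  · have : diamond n T = {x | ‖x.2‖ ≤ x.1 + T / 2} ∩ {x | ‖x.2‖ ≤ T / 2 - x.1} := by
      ext x
      exact mem_diamond_iff
    rw [this]
    exact (isClosed_le (by fun_prop) (by fun_prop)).inter
      (isClosed_le (by fun_prop) (by fun_prop))
  · intro x hx
    obtain ⟨h1, h2⟩ := mem_diamond_iff.1 hx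
    have := norm_nonneg x.2
    refine ⟨⟨?_, ?_⟩, ?_⟩
    · linarith
    · linarith
    · rw [mem_closedBall_zero_iff]
      linarith

/-- Polar coordinates in the spatial directions of the diamond. -/
lemma exists_integral_diamond_eq (k : ℕ) (T : ℝ) :
    ∃ c : ℝ, ∀ g : ℝ × ℝ → ℝ, Continuous g →
      ∫ x in diamond (k + 2) T, g (x.1, ‖x.2‖) = c * ∫ z in halfDiamond T, z.2 ^ k * g z := by
  set E := EuclideanSpace ℝ (Fin (k + 1))
  have hE : Module.finrank ℝ E = k + 1 := by simp [E]
  refine ⟨(k + 1) * (volume : Measure E).real (Metric.ball 0 1), fun g hg => ?_⟩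
  set K : Set (ℝ × ℝ) := {z | z.2 ≤ z.1 + T / 2 ∧ z.2 ≤ T / 2 - z.1}
  have hG : ∀ x : ℝ × E, (diamond (k + 2) T).indicator (fun x => g (x.1, ‖x.2‖)) x
      = K.indicator g (x.1, ‖x.2‖) := by
    intro x
    have : x ∈ diamond (k + 2) T ↔ (x.1, ‖x.2‖) ∈ K := mem_diamond_iff
    by_cases h : (x.1, ‖x.2‖) ∈ K
    · rw [Set.indicator_of_mem h, Set.indicator_of_mem (this.2 h)]
    · rw [Set.indicator_of_notMem h, Set.indicator_of_notMem (mt this.1 h)]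
  have hD : MeasurableSet (diamond (k + 2) T) := (isCompact_diamond _ T).measurableSet
  have hint : Integrable ((diamond (k + 2) T).indicator (fun x => g (x.1, ‖x.2‖)))
      ((volume : Measure ℝ).prod (volume : Measure E)) :=
    (integrable_indicator_iff hD).2
      (ContinuousOn.integrableOn_compact (isCompact_diamond _ T) (by fun_prop))
  have hR := measurableSet_halfDiamond T
  have hgR : Continuous fun z : ℝ × ℝ => z.2 ^ k * g z := by fun_prop
  have hintR : Integrable ((halfDiamond T).indicator (fun z => z.2 ^ k * g z))
      ((volume : Measure ℝ).prod (volume : Measure ℝ)) :=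
    (integrable_indicator_iff hR).2 hgR.integrableOn_halfDiamond
  rw [← integral_indicator hD, ← integral_indicator hR, Measure.volume_eq_prod,
    Measure.volume_eq_prod, integral_prod _ hint, integral_prod _ hintR, ← integral_const_mul]
  congr 1
  ext t
  simp_rw [hG]
  refine (integral_fun_norm_addHaar (volume : Measure E)
    (fun r => K.indicator g (t, r))).trans ?_
  rw [hE, ← integral_indicator measurableSet_Ioi]
  simp only [nsmul_eq_mul, smul_eq_mul, Nat.add_sub_cancel, Nat.cast_add, Nat.cast_one, mul_assoc]
  congr 3
  ext r
  by_cases h0 : 0 < r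
  · rw [Set.indicator_of_mem (Set.mem_Ioi.2 h0)]
    by_cases h : (t, r) ∈ K
    · rw [Set.indicator_of_mem h, Set.indicator_of_mem (show (t, r) ∈ halfDiamond T from ⟨h0, h⟩)]
    · rw [Set.indicator_of_notMem h, Set.indicator_of_notMem (fun h' => h h'.2), mul_zero]
  · rw [Set.indicator_of_notMem (by simpa using h0), Set.indicator_of_notMem (fun h' => h0 h'.1)]

/-- The half-diamond in the coordinates `v = T/2 - t + r` and `w = (T/2 - t - r) / v`. -/
lemma integral_halfDiamond_eq (T : ℝ) (h : ℝ × ℝ → ℝ) :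
    ∫ z in halfDiamond T, h z = ∫ p in Set.Ioc 0 T ×ˢ Set.Ico 0 1,
      p.1 / 2 * h (T / 2 - p.1 * (1 + p.2) / 2, p.1 * (1 - p.2) / 2) := by
  set f : ℝ × ℝ → ℝ × ℝ := fun p => (T / 2 - p.1 * (1 + p.2) / 2, p.1 * (1 - p.2) / 2) with hf
  set f' : ℝ × ℝ → ℝ × ℝ →L[ℝ] ℝ × ℝ := fun p =>
    (Matrix.toLin (.finTwoProd ℝ) (.finTwoProd ℝ)
      !![-((1 + p.2) / 2), -(p.1 / 2); (1 - p.2) / 2, -(p.1 / 2)]).toContinuousLinearMap with hf'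
  have hdet : ∀ p, (f' p).det = p.1 / 2 := by
    intro p
    simp only [hf', LinearMap.det_toContinuousLinearMap, LinearMap.det_toLin,
      Matrix.det_fin_two_of]
    ring
  have hder : ∀ p, HasFDerivAt f (f' p) p := by
    intro p
    simp only [hf', hf]
    rw [Matrix.toLin_finTwoProd_toContinuousLinearMap]
    have h1 : HasFDerivAt (fun p : ℝ × ℝ => p.1) (ContinuousLinearMap.fst ℝ ℝ ℝ) p :=
      hasFDerivAt_fst
    have h2 : HasFDerivAt (fun p : ℝ × ℝ => p.2) (ContinuousLinearMap.snd ℝ ℝ ℝ) p :=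
      hasFDerivAt_snd
    convert! HasFDerivAt.prodMk
      (((h1.mul (h2.const_add 1)).mul_const (1 / 2)).const_sub (T / 2))
      ((h1.mul (h2.const_sub 1)).mul_const (1 / 2)) using 1
    · ext q <;> simp [div_eq_mul_inv]
    · ext <;> simp <;> ring
  have himg : f '' (Set.Ioc 0 T ×ˢ Set.Ico 0 1) = halfDiamond T := by
    ext ⟨t, r⟩
    constructor
    · rintro ⟨⟨v, w⟩, ⟨⟨hv0, hvT⟩, hw0, hw1⟩, heq⟩
      simp only [hf, Prod.mk.injEq] at heq hv0 hvT hw0 hw1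
      obtain ⟨rfl, rfl⟩ := heq
      have : 0 < v * (1 - w) := mul_pos hv0 (by linarith)
      have : 0 ≤ v * w := by positivity
      refine ⟨?_, ?_, ?_⟩ <;> simp only <;> linarith
    · rintro ⟨h0, h1, h2⟩
      simp only at h0 h1 h2
      have hv : 0 < T / 2 - t + r := by linarith
      refine ⟨(T / 2 - t + r, (T / 2 - t - r) / (T / 2 - t + r)),
        ⟨⟨hv, by simp only; linarith⟩, div_nonneg (by linarith) hv.le, ?_⟩, ?_⟩
      · simp only
        rw [div_lt_one hv]
        linarith
      · simp only [hf, Prod.mk.injEq]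
        have := mul_div_cancel₀ (T / 2 - t - r) hv.ne'
        constructor <;> linarith
  have hinj : Set.InjOn f (Set.Ioc 0 T ×ˢ Set.Ico 0 1) := by
    rintro ⟨v, w⟩ ⟨⟨hv, -⟩, -⟩ ⟨v', w'⟩ - heq
    simp only [hf, Prod.mk.injEq] at heq hv
    obtain ⟨h1, h2⟩ := heq
    have hvv : v = v' := by linarith
    subst hvv
    have : v * w = v * w' := by linarith
    rw [mul_left_cancel₀ hv.ne' this]
  have hms : MeasurableSet (Set.Ioc 0 T ×ˢ Set.Ico (0 : ℝ) 1) :=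
    measurableSet_Ioc.prod measurableSet_Ico
  rw [← himg, integral_image_eq_integral_abs_det_fderiv_smul volume hms
    (fun p _ => (hder p).hasFDerivWithinAt) hinj]
  refine setIntegral_congr_fun hms fun p hp => ?_
  have hp0 : 0 < p.1 := hp.1.1
  simp only [hdet, smul_eq_mul]
  rw [abs_of_pos (half_pos hp0)]

/-- The Beta-function recurrence `B(a + 2, k + 1) (a + k + 2) = (a + 1) B(a + 1, k + 1)`. -/
lemma setIntegral_mul_rpow_mul_one_sub_pow {a : ℝ} (ha : 0 ≤ a) (k : ℕ) :
    (∫ w in Set.Ico (0 : ℝ) 1, w * (w ^ a * (1 - w) ^ k)) * (a + k + 2) =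
      (a + 1) * ∫ w in Set.Ico (0 : ℝ) 1, w ^ a * (1 - w) ^ k := by
  have hc : Continuous fun w : ℝ => w ^ a * (1 - w) ^ k :=
    (Real.continuous_rpow_const ha).mul (by fun_prop)
  have hc1 : Continuous fun w : ℝ => w * (w ^ a * (1 - w) ^ k) := continuous_id.mul hc
  have key : ∫ w in (0 : ℝ)..1, ((a + 1) * (w ^ a * (1 - w) ^ k)
      - (a + k + 2) * (w * (w ^ a * (1 - w) ^ k))) = 0 := by
    have := intervalIntegral.integral_eq_sub_of_hasDerivAt (a := (0 : ℝ)) (b := 1)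
      (f := fun w => w ^ (a + 1) * (1 - w) ^ (k + 1))
      (f' := fun w => (a + 1) * (w ^ a * (1 - w) ^ k)
        - (a + k + 2) * (w * (w ^ a * (1 - w) ^ k))) ?_ ?_
    · rw [this]
      simp [Real.zero_rpow (show a + 1 ≠ 0 by linarith)]
    · intro w hw
      rw [Set.uIcc_of_le zero_le_one] at hw
      have h1 : HasDerivAt (fun w : ℝ => w ^ (a + 1)) ((a + 1) * w ^ a) w := by
        simpa using Real.hasDerivAt_rpow_const (x := w) (p := a + 1) (Or.inr (by linarith))
      have h2 := ((hasDerivAt_id w).const_sub 1).fun_pow (k + 1)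
      refine (h1.mul h2).congr_deriv ?_
      have hw1 : w ^ (a + 1) = w ^ a * w := by
        rw [Real.rpow_add' hw.1 (by linarith), Real.rpow_one]
      simp only [hw1, id, Nat.add_sub_cancel]
      push_cast
      ring
    · exact ((hc.const_mul _).sub (hc1.const_mul _)).intervalIntegrable _ _
  rw [intervalIntegral.integral_sub ((hc.const_mul _).intervalIntegrable _ _)
    ((hc1.const_mul _).intervalIntegrable _ _), intervalIntegral.integral_const_mul,
    intervalIntegral.integral_const_mul, intervalIntegral.integral_of_le zero_le_one,
    intervalIntegral.integral_of_le zero_le_one, ← integral_Ico_eq_integral_Ioc,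
    ← integral_Ico_eq_integral_Ioc] at key
  linarith

lemma setIntegral_mul_rpow {T b : ℝ} (hT : 0 < T) (hb : 0 ≤ b) :
    (∫ v in Set.Ioc 0 T, v * v ^ b) * (b + 2) = T * (b + 1) * ∫ v in Set.Ioc 0 T, v ^ b := by
  have h : ∫ v in Set.Ioc 0 T, v * v ^ b = ∫ v in Set.Ioc 0 T, v ^ (b + 1) :=
    setIntegral_congr_fun measurableSet_Ioc fun v hv => by
      simp only [Real.rpow_add_one hv.1.ne', mul_comm]
  rw [h, ← intervalIntegral.integral_of_le hT.le, ← intervalIntegral.integral_of_le hT.le,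
    integral_rpow (Or.inl (by linarith)), integral_rpow (Or.inl (by linarith)),
    Real.zero_rpow (by linarith), Real.zero_rpow (by linarith), Real.rpow_add_one hT.ne' (b + 1)]
  have h1 : b + 1 ≠ 0 := by linarith
  have h2 : b + 1 + 1 ≠ 0 := by linarith
  field_simp
  ring

/-- The integrand `r ^ k * τ ^ m`, with its Jacobian factor, in the coordinates of
`integral_halfDiamond_eq`. -/
lemma half_mul_pow_mul_sqrt_rpow (k : ℕ) (T m v w : ℝ) (hv : 0 < v) (hw : 0 ≤ w) :
    v / 2 * ((v * (1 - w) / 2) ^ k * √((T / 2 - (T / 2 - v * (1 + w) / 2)) ^ 2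
        - (v * (1 - w) / 2) ^ 2) ^ m) =
      (1 / 2) ^ (k + 1) * (v ^ (m + k + 1) * (w ^ (m / 2) * (1 - w) ^ k)) := by
  have h1 : (T / 2 - (T / 2 - v * (1 + w) / 2)) ^ 2 - (v * (1 - w) / 2) ^ 2 = v ^ 2 * w := by
    ring
  have h2 : v ^ (m + k + 1) = v ^ m * v ^ k * v := by
    rw [Real.rpow_add_one hv.ne', Real.rpow_add_natCast hv.ne']
  have h3 : √w ^ m = w ^ (m / 2) := by
    rw [Real.sqrt_eq_rpow, ← Real.rpow_mul hw]
    ring_nf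
  rw [h1, Real.sqrt_mul (sq_nonneg v), Real.sqrt_sq hv.le,
    Real.mul_rpow hv.le (Real.sqrt_nonneg w), h2, h3, div_pow, mul_pow, pow_succ, one_div_pow]
  ring

/-- `∫_{I[p,q]} x⁰ · τ(x,q)^m dx = f̃₄(m) · T · ∫_{I[p,q]} τ(x,q)^m dx`, where
`f̃₄(m) = (1/2)(1 - (m+n)/(m+n+1) - ((m/2+1)(m+n))/((m+n+1)(m/2+n)))`;
in particular `f̃₄(0) = 0`. -/
theorem stmt6 (n : ℕ) (hn : 2 ≤ n) (T m : ℝ) (hT : 0 < T) (hm : 0 ≤ m) :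
    (∫ x in diamond n T, x.1 * tau x (qDiam n T) ^ m) =
      ((1 / 2) * (1 - (m + (n : ℝ)) / (m + (n : ℝ) + 1) -
          ((m / 2 + 1) * (m + (n : ℝ))) / ((m + (n : ℝ) + 1) * (m / 2 + (n : ℝ))))) *
        T * ∫ x in diamond n T, tau x (qDiam n T) ^ m := by
  obtain ⟨k, rfl⟩ : ∃ k, n = k + 2 := ⟨n - 2, by omega⟩
  obtain ⟨c, hc⟩ := exists_integral_diamond_eq k T
  have htau : ∀ x : MinkPt (k + 2), tau x (qDiam (k + 2) T)
      = √((T / 2 - x.1) ^ 2 - ‖x.2‖ ^ 2) := by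
    intro x
    simp [tau, qDiam]
  have hg : Continuous fun z : ℝ × ℝ => √((T / 2 - z.1) ^ 2 - z.2 ^ 2) ^ m :=
    Continuous.rpow_const (by fun_prop) fun _ => Or.inr hm
  simp_rw [htau]
  have e0 := hc _ hg
  have e1 := hc _ (continuous_fst.mul hg)
  simp only [Pi.mul_apply] at e0 e1
  set φ : ℝ → ℝ := fun v => v ^ (m + k + 1) with hφ
  set ψ : ℝ → ℝ := fun w => w ^ (m / 2) * (1 - w) ^ k with hψ
  set S : Set (ℝ × ℝ) := Set.Ioc 0 T ×ˢ Set.Ico 0 1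
  have hmk : 0 ≤ m + k + 1 := by positivity
  have hφc : Continuous φ := Real.continuous_rpow_const hmk
  have hψc : Continuous ψ := (Real.continuous_rpow_const (by positivity)).mul (by fun_prop)
  have hms : MeasurableSet S := measurableSet_Ioc.prod measurableSet_Ico
  have hintS : ∀ f : ℝ × ℝ → ℝ, Continuous f → IntegrableOn f S := fun f hf =>
    (hf.continuousOn.integrableOn_compact (isCompact_Icc.prod isCompact_Icc)).mono_set
      (Set.prod_mono Set.Ioc_subset_Icc_self Set.Ico_subset_Icc_self)
  have hprod : ∀ f g : ℝ → ℝ, ∫ p in S, f p.1 * g p.2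
      = (∫ v in Set.Ioc 0 T, f v) * ∫ w in Set.Ico 0 1, g w := fun f g =>
    setIntegral_prod_mul f g _ _
  have i0 : ∫ z in halfDiamond T, z.2 ^ k * √((T / 2 - z.1) ^ 2 - z.2 ^ 2) ^ m
      = (1 / 2) ^ (k + 1) * ((∫ v in Set.Ioc 0 T, φ v) * ∫ w in Set.Ico 0 1, ψ w) := by
    rw [integral_halfDiamond_eq, ← hprod, ← integral_const_mul]
    exact setIntegral_congr_fun hms fun p hp =>
      half_mul_pow_mul_sqrt_rpow k T m p.1 p.2 hp.1.1 hp.2.1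
  have i1 : ∫ z in halfDiamond T, z.2 ^ k * (z.1 * √((T / 2 - z.1) ^ 2 - z.2 ^ 2) ^ m)
      = (1 / 2) ^ (k + 1) * (T / 2 * ((∫ v in Set.Ioc 0 T, φ v) * ∫ w in Set.Ico 0 1, ψ w)
        - 1 / 2 * ((∫ v in Set.Ioc 0 T, v * φ v) * ∫ w in Set.Ico 0 1, ψ w)
        - 1 / 2 * ((∫ v in Set.Ioc 0 T, v * φ v) * ∫ w in Set.Ico 0 1, w * ψ w)) := by
    have j0 := hintS (fun p => T / 2 * (φ p.1 * ψ p.2)) (by fun_prop)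
    have j1 := hintS (fun p => 1 / 2 * (p.1 * φ p.1 * ψ p.2)) (by fun_prop)
    have j01 := hintS
      (fun p => T / 2 * (φ p.1 * ψ p.2) - 1 / 2 * (p.1 * φ p.1 * ψ p.2)) (by fun_prop)
    have j2 := hintS (fun p => 1 / 2 * (p.1 * φ p.1 * (p.2 * ψ p.2))) (by fun_prop)
    rw [integral_halfDiamond_eq, ← hprod, ← hprod (fun v => v * φ v),
      ← hprod (fun v => v * φ v) (fun w => w * ψ w), ← integral_const_mul (T / 2),
      ← integral_const_mul (1 / 2), ← integral_const_mul (1 / 2), ← integral_sub j0 j1,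
      ← integral_sub j01 j2, ← integral_const_mul]
    refine setIntegral_congr_fun hms fun p hp => ?_
    have := half_mul_pow_mul_sqrt_rpow k T m p.1 p.2 hp.1.1 hp.2.1
    simp only [hφ, hψ]
    linear_combination (T / 2 - p.1 * (1 + p.2) / 2) * this
  have hA := setIntegral_mul_rpow hT hmk
  have hB := setIntegral_mul_rpow_mul_one_sub_pow (div_nonneg hm zero_le_two) k
  rw [i0] at e0
  rw [i1] at e1
  have ha : m + k + 1 + 2 ≠ 0 := by positivity
  have hb : m / 2 + k + 2 ≠ 0 := by positivity
  rw [← eq_div_iff ha] at hA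
  rw [← eq_div_iff hb] at hB
  simp only [hφ, hψ] at e0 e1
  rw [e0, e1, hA, hB]
  have ha' : m + (k + 2) + 1 ≠ 0 := by positivity
  have hb' : m + 2 * (k + 2) ≠ 0 := by positivity
  push_cast
  generalize (∫ v in Set.Ioc 0 T, v ^ (m + k + 1)) = A
  generalize (∫ w in Set.Ico (0 : ℝ) 1, w ^ (m / 2) * (1 - w) ^ k) = B
  rw [show m + k + 1 + 2 = m + (k + 2) + 1 by ring, show m / 2 + k + 2 = m / 2 + (k + 2) by ring]
  rw [show m / 2 + k + 2 = m / 2 + (k + 2) by ring] at hb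
  field_simp
  ring
end

section
/- Let n ≥ 2 be an integer, T > 0, and m ≥ 0 a real number. Then ∫_{I[p,q]} (T/2 - x⁰)² · τ(x,q)^m dx = f₄(m) · T² · ∫_{I[p,q]} τ(x,q)^m dx, where f₄(m) = 1/4 - f̃₄(m) + f₃(m), with f₃(m) = (8n + m(m+2)(m+n+2)) / (4(m+n+2)(2n+m)(2n+m+2)) and f̃₄(m) = (1/2)·(1 - (m+n)/(m+n+1) - ((m/2+1)(m+n))/((m+n+1)(m/2+n))). -/
open MeasureTheory

/-- `f₃(m) = (8n + m(m+2)(m+n+2))/(4(m+n+2)(2n+m)(2n+m+2))`. -/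
noncomputable def f₃ (n m : ℝ) : ℝ :=
  (8 * n + m * (m + 2) * (m + n + 2)) / (4 * (m + n + 2) * (2 * n + m) * (2 * n + m + 2))

/-- `f̃₄(m) = (1/2)(1 - (m+n)/(m+n+1) - ((m/2+1)(m+n))/((m+n+1)(m/2+n)))`. -/
noncomputable def f₄tilde (n m : ℝ) : ℝ :=
  (1 / 2) * (1 - (m + n) / (m + n + 1) - ((m / 2 + 1) * (m + n)) / ((m + n + 1) * (m / 2 + n)))

open Module Real in
/-- Homogeneity of the spatial slices of a solid cone. -/
lemma setIntegral_cone_slice_scale {E : Type*} [NormedAddCommGroup E] [InnerProductSpace ℝ E]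
    [FiniteDimensional ℝ E] [MeasurableSpace E] [BorelSpace E] (k : ℕ) (m : ℝ) {v : ℝ}
    (hv : 0 < v) :
    ∫ y in {y : E | 2 * ‖y‖ ≤ v}, (v - ‖y‖) ^ k * √((v - ‖y‖) ^ 2 - ‖y‖ ^ 2) ^ m =
      v ^ (m + (k + finrank ℝ E : ℕ)) *
        ∫ y in {y : E | 2 * ‖y‖ ≤ 1}, (1 - ‖y‖) ^ k * √((1 - ‖y‖) ^ 2 - ‖y‖ ^ 2) ^ m := by
  have hmeas (a : ℝ) : MeasurableSet {y : E | 2 * ‖y‖ ≤ a} :=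
    measurableSet_le (by fun_prop) (by fun_prop)
  rw [← integral_indicator (hmeas v), ← integral_indicator (hmeas 1)]
  have h := Measure.integral_comp_smul (volume : Measure E)
    ({y : E | 2 * ‖y‖ ≤ v}.indicator
      fun y ↦ (v - ‖y‖) ^ k * √((v - ‖y‖) ^ 2 - ‖y‖ ^ 2) ^ m) v
  have hscale (z : E) : ({y : E | 2 * ‖y‖ ≤ v}.indicator
      fun y ↦ (v - ‖y‖) ^ k * √((v - ‖y‖) ^ 2 - ‖y‖ ^ 2) ^ m) (v • z) =
      v ^ (m + (k : ℕ)) * ({y : E | 2 * ‖y‖ ≤ 1}.indicator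
        fun y ↦ (1 - ‖y‖) ^ k * √((1 - ‖y‖) ^ 2 - ‖y‖ ^ 2) ^ m) z := by
    have hmem : v • z ∈ {y : E | 2 * ‖y‖ ≤ v} ↔ z ∈ {y : E | 2 * ‖y‖ ≤ 1} := by
      simp only [Set.mem_ofPred_eq, norm_smul, norm_eq_abs, abs_of_pos hv]
      constructor <;> intro h <;> nlinarith
    by_cases hz : z ∈ {y : E | 2 * ‖y‖ ≤ 1}
    · rw [Set.indicator_of_mem (hmem.2 hz), Set.indicator_of_mem hz, norm_smul, norm_eq_abs,
        abs_of_pos hv,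
        show (v - v * ‖z‖) ^ 2 - (v * ‖z‖) ^ 2 = v ^ 2 * ((1 - ‖z‖) ^ 2 - ‖z‖ ^ 2) by ring,
        sqrt_mul (sq_nonneg v), sqrt_sq hv.le, mul_rpow hv.le (sqrt_nonneg _),
        rpow_add_natCast hv.ne', show v - v * ‖z‖ = v * (1 - ‖z‖) by ring, mul_pow]
      ring
    · rw [Set.indicator_of_notMem (mt hmem.1 hz), Set.indicator_of_notMem hz, mul_zero]
  simp only [hscale, integral_const_mul] at h
  rw [abs_of_pos (by positivity), smul_eq_mul, eq_inv_mul_iff_mul_eq₀ (by positivity)] at h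
  rw [← h, Nat.cast_add, ← add_assoc, rpow_add_natCast hv.ne' (m + k)]
  ring

open Module Real in
/-- The integral over the unit slice in spherical coordinates. -/
lemma setIntegral_cone_slice_one {E : Type*} [NormedAddCommGroup E] [InnerProductSpace ℝ E]
    [FiniteDimensional ℝ E] [Nontrivial E] [MeasurableSpace E] [BorelSpace E] (k : ℕ) (m : ℝ) :
    ∫ y in {y : E | 2 * ‖y‖ ≤ 1}, (1 - ‖y‖) ^ k * √((1 - ‖y‖) ^ 2 - ‖y‖ ^ 2) ^ m =
      finrank ℝ E * volume.real (Metric.ball (0 : E) 1) *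
        ∫ r in (0 : ℝ)..1 / 2, r ^ (finrank ℝ E - 1) * (1 - r) ^ k * (1 - 2 * r) ^ (m / 2) := by
  have hmeas : MeasurableSet {y : E | 2 * ‖y‖ ≤ 1} :=
    measurableSet_le (by fun_prop) (by fun_prop)
  rw [← integral_indicator hmeas]
  have h := integral_fun_norm_addHaar (volume : Measure E)
    ((Set.Iic (1 / 2)).indicator fun r : ℝ ↦ (1 - r) ^ k * √((1 - r) ^ 2 - r ^ 2) ^ m)
  have hind (y : E) : {y : E | 2 * ‖y‖ ≤ 1}.indicator
      (fun y ↦ (1 - ‖y‖) ^ k * √((1 - ‖y‖) ^ 2 - ‖y‖ ^ 2) ^ m) y =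
      (Set.Iic (1 / 2)).indicator (fun r : ℝ ↦ (1 - r) ^ k * √((1 - r) ^ 2 - r ^ 2) ^ m) ‖y‖ := by
    have : y ∈ {y : E | 2 * ‖y‖ ≤ 1} ↔ ‖y‖ ∈ Set.Iic (1 / 2 : ℝ) := by
      simp only [Set.mem_ofPred_eq, Set.mem_Iic]
      constructor <;> intro h <;> linarith
    by_cases hy : ‖y‖ ∈ Set.Iic (1 / 2 : ℝ)
    · rw [Set.indicator_of_mem hy, Set.indicator_of_mem (this.2 hy)]
    · rw [Set.indicator_of_notMem hy, Set.indicator_of_notMem (mt this.1 hy)]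
  simp only [hind, h, nsmul_eq_mul, smul_eq_mul, mul_assoc]
  congr 2
  rw [intervalIntegral.integral_of_le (by norm_num), ← Set.Ioi_inter_Iic,
    ← setIntegral_indicator measurableSet_Iic]
  refine setIntegral_congr_fun measurableSet_Ioi fun r _ ↦ ?_
  by_cases hr' : r ∈ Set.Iic (1 / 2 : ℝ)
  · simp only [Set.indicator_of_mem hr']
    rw [show (1 - r) ^ 2 - r ^ 2 = 1 - 2 * r by ring, sqrt_eq_rpow, ← rpow_mul
      (by have := Set.mem_Iic.1 hr'; linarith)]
    ring_nf
  · simp only [Set.indicator_of_notMem hr', mul_zero]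

open Module Real in
/-- Moments of the distance to the top tip of a causal diamond, in light-cone coordinates. -/
lemma setIntegral_diamond_moment {E : Type*} [NormedAddCommGroup E] [InnerProductSpace ℝ E]
    [FiniteDimensional ℝ E] [Nontrivial E] [MeasurableSpace E] [BorelSpace E] (k : ℕ) {m T : ℝ}
    (hm : 0 ≤ m) (hT : 0 < T) :
    ∫ x in {x : ℝ × E | ‖x.2‖ ≤ x.1 + T / 2 ∧ ‖x.2‖ ≤ T / 2 - x.1},
        (T / 2 - x.1) ^ k * √((T / 2 - x.1) ^ 2 - ‖x.2‖ ^ 2) ^ m =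
      T ^ (m + (k + finrank ℝ E : ℕ) + 1) / (m + (k + finrank ℝ E : ℕ) + 1) *
        (finrank ℝ E * volume.real (Metric.ball (0 : E) 1) *
        ∫ r in (0 : ℝ)..1 / 2, r ^ (finrank ℝ E - 1) * (1 - r) ^ k * (1 - 2 * r) ^ (m / 2)) := by
  let φ : ℝ × E → ℝ × E := fun x ↦ (T / 2 - x.1 + ‖x.2‖, x.2)
  have hφ : Function.Involutive φ := fun x ↦ Prod.ext (by simp only [φ]; ring) rfl
  have hφm : Measurable φ := by fun_prop
  let e := MeasurableEquiv.ofInvolutive φ hφ hφm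
  have hmp : MeasurePreserving e volume volume := by
    have hskew : MeasurePreserving (fun p : E × ℝ ↦ (p.1, T / 2 + ‖p.1‖ - p.2))
        (volume.prod volume) (volume.prod volume) :=
      (MeasurePreserving.id (volume : Measure E)).skew_product (μc := (volume : Measure ℝ))
        (g := fun y v ↦ T / 2 + ‖y‖ - v)
        (by fun_prop)
        (.of_forall fun y ↦ Measure.map_sub_left_eq_self volume (T / 2 + ‖y‖))
    have he : ⇑e = (Prod.swap ∘ fun p : E × ℝ ↦ (p.1, T / 2 + ‖p.1‖ - p.2)) ∘ Prod.swap := by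
      funext x
      refine Prod.ext ?_ rfl
      simp only [e, MeasurableEquiv.ofInvolutive_apply, φ, Function.comp_apply, Prod.swap]
      ring
    rw [he]
    exact (Measure.measurePreserving_swap.comp hskew).comp Measure.measurePreserving_swap
  have hpre : e ⁻¹' {x : ℝ × E | ‖x.2‖ ≤ x.1 + T / 2 ∧ ‖x.2‖ ≤ T / 2 - x.1} =
      {x : ℝ × E | 2 * ‖x.2‖ ≤ x.1 ∧ x.1 ≤ T} := by
    ext x
    simp only [e, MeasurableEquiv.ofInvolutive_apply, φ, Set.mem_preimage, Set.mem_ofPred_eq]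
    constructor <;> rintro ⟨h₁, h₂⟩ <;> constructor <;> linarith
  rw [← hmp.setIntegral_preimage_emb e.measurableEmbedding, hpre]
  have hval (x : ℝ × E) : T / 2 - (e x).1 = x.1 - ‖x.2‖ := by
    simp only [e, MeasurableEquiv.ofInvolutive_apply, φ]
    ring
  have hsnd (x : ℝ × E) : (e x).2 = x.2 := rfl
  simp only [hval, hsnd]
  have hclosed : IsClosed {x : ℝ × E | 2 * ‖x.2‖ ≤ x.1 ∧ x.1 ≤ T} :=
    (isClosed_le (f := fun x : ℝ × E ↦ 2 * ‖x.2‖) (g := Prod.fst) (by fun_prop)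
      (by fun_prop)).inter (isClosed_le (f := Prod.fst) (g := fun _ ↦ T) (by fun_prop)
      (by fun_prop))
  have hcompact : IsCompact {x : ℝ × E | 2 * ‖x.2‖ ≤ x.1 ∧ x.1 ≤ T} := by
    refine ((isCompact_Icc (a := (0 : ℝ)) (b := T)).prod
      (isCompact_closedBall (0 : E) T)).of_isClosed_subset hclosed fun x hx ↦ ?_
    obtain ⟨h₁, h₂⟩ := hx
    have := norm_nonneg x.2
    exact ⟨⟨by linarith, h₂⟩, mem_closedBall_zero_iff.2 (by linarith)⟩
  have hint : IntegrableOn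
      (fun x : ℝ × E ↦ (x.1 - ‖x.2‖) ^ k * √((x.1 - ‖x.2‖) ^ 2 - ‖x.2‖ ^ 2) ^ m)
      {x : ℝ × E | 2 * ‖x.2‖ ≤ x.1 ∧ x.1 ≤ T} := by
    refine Continuous.continuousOn ?_ |>.integrableOn_compact hcompact
    exact (by fun_prop : Continuous fun x : ℝ × E ↦ (x.1 - ‖x.2‖) ^ k).mul
      ((by fun_prop : Continuous fun x : ℝ × E ↦ √((x.1 - ‖x.2‖) ^ 2 - ‖x.2‖ ^ 2)).rpow_const
        fun _ ↦ .inr hm)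
  rw [← integral_indicator hclosed.measurableSet, Measure.volume_eq_prod,
    integral_prod _ ((integrable_indicator_iff hclosed.measurableSet).2 hint)]
  have hslice (v : ℝ) (hv : v ≠ 0) :
      ∫ y, {x : ℝ × E | 2 * ‖x.2‖ ≤ x.1 ∧ x.1 ≤ T}.indicator
        (fun x ↦ (x.1 - ‖x.2‖) ^ k * √((x.1 - ‖x.2‖) ^ 2 - ‖x.2‖ ^ 2) ^ m) (v, y) =
      (Set.Ioc 0 T).indicator (fun v ↦ v ^ (m + (k + finrank ℝ E : ℕ)) *
        ∫ y in {y : E | 2 * ‖y‖ ≤ 1}, (1 - ‖y‖) ^ k * √((1 - ‖y‖) ^ 2 - ‖y‖ ^ 2) ^ m) v := by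
    by_cases hvT : v ∈ Set.Ioc 0 T
    · rw [Set.indicator_of_mem hvT, ← setIntegral_cone_slice_scale k m hvT.1,
        ← integral_indicator (measurableSet_le (by fun_prop) (by fun_prop))]
      refine integral_congr_ae (.of_forall fun y ↦ ?_)
      simp [Set.indicator_apply, hvT.2]
    · rw [Set.indicator_of_notMem hvT]
      refine integral_eq_zero_of_ae (.of_forall fun y ↦ Set.indicator_of_notMem ?_ _)
      rintro ⟨h₁, h₂⟩
      have := norm_nonneg y
      exact hvT ⟨lt_of_le_of_ne (by simp only at h₁; linarith) hv.symm, h₂⟩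
  rw [integral_congr_ae ((Measure.ae_ne volume (0 : ℝ)).mono hslice),
    integral_indicator measurableSet_Ioc, integral_mul_const, setIntegral_cone_slice_one,
    ← intervalIntegral.integral_of_le hT.le, integral_rpow (.inl (by
      have : (0 : ℝ) ≤ (k + finrank ℝ E : ℕ) := by positivity
      linarith)), zero_rpow (by positivity), sub_zero]

/-- Recurrence for the incomplete beta-type integrals `∫ r^p (1-2r)^μ` over `[0, 1/2]`. -/
lemma integral_pow_mul_one_sub_two_mul_rpow_succ (p : ℕ) {μ : ℝ} (hμ : 0 ≤ μ) :
    2 * (p + μ + 2) * ∫ r in (0 : ℝ)..1 / 2, r ^ (p + 1) * (1 - 2 * r) ^ μ =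
      (p + 1) * ∫ r in (0 : ℝ)..1 / 2, r ^ p * (1 - 2 * r) ^ μ := by
  have hcont (j : ℕ) : Continuous fun r : ℝ ↦ r ^ j * (1 - 2 * r) ^ μ :=
    (continuous_pow j).mul
      ((by fun_prop : Continuous fun r : ℝ ↦ 1 - 2 * r).rpow_const fun _ ↦ .inr hμ)
  have hderiv (r : ℝ) (hr : r ∈ Set.uIcc (0 : ℝ) (1 / 2)) :
      HasDerivAt (fun r : ℝ ↦ r ^ (p + 1) * (1 - 2 * r) ^ (μ + 1))
        ((p + 1) * (r ^ p * (1 - 2 * r) ^ μ) -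
          2 * (p + μ + 2) * (r ^ (p + 1) * (1 - 2 * r) ^ μ)) r := by
    have h₁ : HasDerivAt (fun r : ℝ ↦ 1 - 2 * r) (-2) r := by
      simpa using ((hasDerivAt_id r).const_mul 2).const_sub 1
    have h₂ := (hasDerivAt_pow (p + 1) r).mul (h₁.rpow_const (p := μ + 1) (.inr (by linarith)))
    have hr' : 0 ≤ 1 - 2 * r := by
      rw [Set.uIcc_of_le (by norm_num)] at hr
      linarith [hr.2]
    refine h₂.congr_deriv ?_
    rw [add_sub_cancel_right, Real.rpow_add_one' hr' (by positivity), add_tsub_cancel_right]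
    push_cast
    ring
  have h := intervalIntegral.integral_eq_sub_of_hasDerivAt hderiv
    ((((hcont p).const_mul _).sub ((hcont (p + 1)).const_mul _)).intervalIntegrable _ _)
  rw [intervalIntegral.integral_sub (((hcont p).const_mul _).intervalIntegrable _ _)
    (((hcont (p + 1)).const_mul _).intervalIntegrable _ _),
    intervalIntegral.integral_const_mul, intervalIntegral.integral_const_mul] at h
  norm_num [Real.zero_rpow (show μ + 1 ≠ 0 by positivity)] at h
  norm_num
  linarith

/-- The second moment of `1 - r` against `r^p (1-2r)^μ` on `[0, 1/2]`. -/
lemma integral_pow_mul_one_sub_sq_mul_rpow (p : ℕ) {μ : ℝ} (hμ : 0 ≤ μ) :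
    ∫ r in (0 : ℝ)..1 / 2, r ^ p * (1 - r) ^ 2 * (1 - 2 * r) ^ μ =
      (1 - (p + 1) / (p + μ + 2) + (p + 1) * (p + 2) / (4 * (p + μ + 2) * (p + μ + 3))) *
        ∫ r in (0 : ℝ)..1 / 2, r ^ p * (1 - 2 * r) ^ μ := by
  have hint (j : ℕ) : IntervalIntegrable (fun r : ℝ ↦ r ^ j * (1 - 2 * r) ^ μ) volume 0 (1 / 2) :=
    ((continuous_pow j).mul ((by fun_prop : Continuous fun r : ℝ ↦ 1 - 2 * r).rpow_const
      fun _ ↦ .inr hμ)).intervalIntegrable _ _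
  have hexp (r : ℝ) : r ^ p * (1 - r) ^ 2 * (1 - 2 * r) ^ μ =
      r ^ p * (1 - 2 * r) ^ μ - 2 * (r ^ (p + 1) * (1 - 2 * r) ^ μ) +
        r ^ (p + 1 + 1) * (1 - 2 * r) ^ μ := by ring
  simp only [hexp]
  rw [intervalIntegral.integral_add ((hint p).sub ((hint (p + 1)).const_mul 2)) (hint (p + 1 + 1)),
    intervalIntegral.integral_sub (hint p) ((hint (p + 1)).const_mul 2),
    intervalIntegral.integral_const_mul]
  have h₁ := integral_pow_mul_one_sub_two_mul_rpow_succ p hμ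
  have h₂ := integral_pow_mul_one_sub_two_mul_rpow_succ (p + 1) hμ
  push_cast at h₂
  rw [mul_comm, ← eq_div_iff (by positivity)] at h₁ h₂
  rw [h₂, h₁]
  field_simp
  ring

/-- `∫_{I[p,q]} (T/2 - x⁰)² τ(x,q)^m dx = f₄(m) · T² · ∫_{I[p,q]} τ(x,q)^m dx`, where
`f₄(m) = 1/4 - f̃₄(m) + f₃(m)`. -/
theorem stmt7 (n : ℕ) (hn : 2 ≤ n) (T m : ℝ) (hT : 0 < T) (hm : 0 ≤ m) :
    (∫ x in diamond n T, (T / 2 - x.1) ^ 2 * tau x (qDiam n T) ^ m) =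
      (1 / 4 - f₄tilde (n : ℝ) m + f₃ (n : ℝ) m) *
        T ^ 2 * ∫ x in diamond n T, tau x (qDiam n T) ^ m := by
  obtain ⟨d, rfl⟩ := Nat.exists_eq_add_of_le' hn
  have hset : diamond (d + 2) T = {x | ‖x.2‖ ≤ x.1 + T / 2 ∧ ‖x.2‖ ≤ T / 2 - x.1} := by
    ext x
    simp [diamond, causalLE, pDiam, qDiam]
  have hdim : Module.finrank ℝ (EuclideanSpace ℝ (Fin (d + 2 - 1))) = d + 1 := by simp
  have : Nontrivial (EuclideanSpace ℝ (Fin (d + 2 - 1))) :=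
    Module.nontrivial_of_finrank_pos (R := ℝ) (by omega)
  have h₂ := setIntegral_diamond_moment (E := EuclideanSpace ℝ (Fin (d + 2 - 1))) 2 hm hT
  have h₀ := setIntegral_diamond_moment (E := EuclideanSpace ℝ (Fin (d + 2 - 1))) 0 hm hT
  simp only [hdim, pow_zero, one_mul, mul_one, add_tsub_cancel_right] at h₂ h₀
  rw [integral_pow_mul_one_sub_sq_mul_rpow d (by positivity : 0 ≤ m / 2)] at h₂
  simp only [hset, tau, qDiam, zero_sub, norm_neg]
  rw [h₂, h₀, show m + (2 + (d + 1) : ℕ) + 1 = m + (0 + (d + 1) : ℕ) + 1 + (2 : ℕ) by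
    push_cast; ring, Real.rpow_add_natCast hT.ne', f₃, f₄tilde]
  push_cast
  field_simp
  ring
end

section
/- (Meyer's k-chain formula in flat spacetime.) Let n ≥ 2 and k ≥ 1 be integers and T > 0. The Lebesgue measure (on (ℝ^n)^k) of the set of k-chains { (x₁,…,x_k) ∈ (ℝ^n)^k : p ⪯ x₁ ⪯ x₂ ⪯ ⋯ ⪯ x_k ⪯ q } equals χ_k · V₀^k, where V₀ is the Lebesgue volume of I[p,q] and χ_k = (1/k) · ( Γ(n+1)/2 )^{k-1} · Γ(n/2)·Γ(n) / ( Γ(kn/2)·Γ((k+1)n/2) ). In particular χ₁ = 1. -/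
open MeasureTheory

/-- Meyer's constant
`χ_k = (1/k)·(Γ(n+1)/2)^{k-1}·Γ(n/2)Γ(n)/(Γ(kn/2)Γ((k+1)n/2))`. -/
noncomputable def chi (n k : ℕ) : ℝ :=
  (1 / (k : ℝ)) * (Real.Gamma ((n : ℝ) + 1) / 2) ^ (k - 1) *
    (Real.Gamma ((n : ℝ) / 2) * Real.Gamma (n : ℝ)) /
    (Real.Gamma ((k : ℝ) * n / 2) * Real.Gamma (((k : ℝ) + 1) * n / 2))


open Set ProbabilityTheory

/-- The Minkowski quadratic form. -/
noncomputable def minkSq {n : ℕ} (x : MinkPt n) : ℝ := x.1 ^ 2 - ‖x.2‖ ^ 2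

/-- The set of points causally between `x` and `y`. -/
def causalInterval {n : ℕ} (x y : MinkPt n) : Set (MinkPt n) :=
  {z | causalLE x z ∧ causalLE z y}

/-- The integral of `(1 - ‖y‖) ^ m` over the unit ball of `ℝ^{n-1}`. -/
noncomputable def ballIntegral (n : ℕ) (m : ℝ) : ℝ :=
  ((n - 1 : ℕ) : ℝ) * volume.real (Metric.ball (0 : EuclideanSpace ℝ (Fin (n - 1))) 1) *
    beta ((n - 1 : ℕ) : ℝ) (m + 1)

/-- The integral of `minkSq ^ m` over a causal interval of unit proper time. -/
noncomputable def diamondConst (n : ℕ) (m : ℝ) : ℝ :=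
  (1 / 2) ^ (n - 1) * ballIntegral n m / (2 * m + n)

lemma measurable_minkSq {n : ℕ} : Measurable (minkSq (n := n)) := by
  unfold minkSq; fun_prop

lemma measurableSet_setOf_causalLE {α : Type*} [MeasurableSpace α] {n : ℕ} {f g : α → MinkPt n}
    (hf : Measurable f) (hg : Measurable g) : MeasurableSet {a | causalLE (f a) (g a)} := by
  unfold causalLE
  exact measurableSet_le (by fun_prop) (by fun_prop)

lemma measurableSet_causalInterval {n : ℕ} (x y : MinkPt n) :
    MeasurableSet (causalInterval x y) :=
  (measurableSet_setOf_causalLE measurable_const measurable_id).inter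
    (measurableSet_setOf_causalLE measurable_id measurable_const)

lemma integral_pow_mul_one_sub_rpow {d : ℕ} (hd : 0 < d) {m : ℝ} (hm : 0 ≤ m) :
    ∫ y in Ioi (0 : ℝ), y ^ (d - 1) * (Iic (1 : ℝ)).indicator (fun y => (1 - y) ^ m) y =
      beta d (m + 1) := by
  have hd' : (0 : ℝ) < d := by exact_mod_cast hd
  have hb : 0 < beta d (m + 1) := beta_pos hd' (by linarith)
  have h1 : ∫ y, betaPDFReal d (m + 1) y = 1 := by
    rw [integral_eq_lintegral_of_nonneg_ae]
    · have := lintegral_betaPDF_eq_one hd' (show 0 < m + 1 by linarith)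
      unfold betaPDF at this
      rw [this, ENNReal.toReal_one]
    · refine Filter.Eventually.of_forall fun y => ?_
      by_cases hy : 0 < y ∧ y < 1
      · exact (betaPDFReal_pos hy.1 hy.2 hd' (by linarith)).le
      · simp [betaPDFReal, hy]
    · exact (stronglyMeasurable_betaPDFReal _ _).aestronglyMeasurable
  rw [← integral_indicator measurableSet_Ioi]
  calc _ = ∫ y, beta d (m + 1) * betaPDFReal d (m + 1) y := by
        refine integral_congr_ae ?_
        filter_upwards [compl_mem_ae_iff.2 (measure_singleton (1 : ℝ))] with y hy
        have hy1 : y ≠ 1 := hy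
        by_cases h0 : 0 < y
        · by_cases h2 : y < 1
          · rw [indicator_of_mem (by exact h0), indicator_of_mem (by exact h2.le), betaPDFReal,
              if_pos ⟨h0, h2⟩, ← Real.rpow_natCast, Nat.cast_sub hd]
            simp only [Nat.cast_one, add_sub_cancel_right]
            field_simp
          · have h3 : y ∉ Iic (1 : ℝ) := fun h => h2 (lt_of_le_of_ne h hy1)
            simp [betaPDFReal, h2, h3]
        · simp [betaPDFReal, h0]
    _ = _ := by rw [integral_const_mul, h1, mul_one]

lemma lintegral_one_sub_norm_rpow {n : ℕ} (hn : 2 ≤ n) {m : ℝ} (hm : 0 ≤ m) :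
    ∫⁻ y in Metric.closedBall (0 : EuclideanSpace ℝ (Fin (n - 1))) 1,
      ENNReal.ofReal ((1 - ‖y‖) ^ m) = ENNReal.ofReal (ballIntegral n m) := by
  have hd : 0 < n - 1 := by omega
  have : Nonempty (Fin (n - 1)) := ⟨⟨0, hd⟩⟩
  have hint : IntegrableOn (fun y : EuclideanSpace ℝ (Fin (n - 1)) => (1 - ‖y‖) ^ m)
      (Metric.closedBall 0 1) := by
    refine ContinuousOn.integrableOn_compact (isCompact_closedBall _ _) (Continuous.continuousOn ?_)
    exact (continuous_const.sub continuous_norm).rpow_const fun _ => Or.inr hm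
  rw [← ofReal_integral_eq_lintegral_ofReal hint]
  · congr 1
    rw [← integral_indicator measurableSet_closedBall]
    have h := integral_fun_norm_addHaar (volume : Measure (EuclideanSpace ℝ (Fin (n - 1))))
      ((Iic (1 : ℝ)).indicator (fun y => (1 - y) ^ m))
    simp only [finrank_euclideanSpace, Fintype.card_fin, nsmul_eq_mul, smul_eq_mul] at h
    rw [integral_pow_mul_one_sub_rpow hd hm] at h
    rw [ballIntegral, mul_assoc, ← h]
    congr 1 with y
    simp [indicator]
  · filter_upwards [ae_restrict_mem measurableSet_closedBall] with y hy
    have : ‖y‖ ≤ 1 := by simpa using hy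
    exact Real.rpow_nonneg (by linarith) _

lemma lintegral_comp_smul_euclidean {d : ℕ} {r : ℝ} (hr : 0 < r)
    {g : EuclideanSpace ℝ (Fin d) → ENNReal} (hg : Measurable g) :
    ∫⁻ x, g x = ENNReal.ofReal (r ^ d) * ∫⁻ y, g (r • y) := by
  have h := Measure.map_addHaar_smul (volume : Measure (EuclideanSpace ℝ (Fin d))) hr.ne'
  have h2 : ∫⁻ y, g (r • y) = ∫⁻ y, g y ∂(Measure.map (r • ·) volume) :=
    (lintegral_map hg (measurable_const_smul r)).symm
  rw [h2, h, lintegral_smul_measure, smul_eq_mul, ← mul_assoc, finrank_euclideanSpace,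
    Fintype.card_fin, ← ENNReal.ofReal_mul (by positivity), abs_of_pos (by positivity),
    mul_inv_cancel₀ (by positivity), ENNReal.ofReal_one, one_mul]

lemma setLIntegral_rpow_Ioc {T s : ℝ} (hT : 0 < T) (hs : 0 ≤ s) :
    ∫⁻ u in Ioc 0 T, ENNReal.ofReal (u ^ s) = ENNReal.ofReal (T ^ (s + 1) / (s + 1)) := by
  have hi : IntervalIntegrable (fun u : ℝ => u ^ s) volume 0 T :=
    intervalIntegral.intervalIntegrable_rpow' (by linarith)
  rw [← ofReal_integral_eq_lintegral_ofReal
    ((intervalIntegrable_iff_integrableOn_Ioc_of_le hT.le).1 hi),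
    ← intervalIntegral.integral_of_le hT.le, integral_rpow (Or.inl (by linarith)),
    Real.zero_rpow (by linarith), sub_zero]
  filter_upwards [ae_restrict_mem measurableSet_Ioc] with u hu
  exact Real.rpow_nonneg hu.1.le _

lemma lintegral_scaled_ball {n : ℕ} (hn : 2 ≤ n) {m : ℝ} (hm : 0 ≤ m) {u : ℝ} (hu : 0 < u) :
    ∫⁻ x in Metric.closedBall (0 : EuclideanSpace ℝ (Fin (n - 1))) (u / 2),
      ENNReal.ofReal ((u * (u - 2 * ‖x‖)) ^ m) =
    ENNReal.ofReal (u ^ (2 * m + (n - 1))) *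
      ENNReal.ofReal ((1 / 2) ^ (n - 1) * ballIntegral n m) := by
  have hm' : Measurable (fun x : EuclideanSpace ℝ (Fin (n - 1)) =>
    ENNReal.ofReal ((u * (u - 2 * ‖x‖)) ^ m)) := by fun_prop
  rw [← lintegral_indicator measurableSet_closedBall,
    lintegral_comp_smul_euclidean (r := u / 2) (by positivity)
      (hm'.indicator measurableSet_closedBall)]
  have h1 : ∀ y : EuclideanSpace ℝ (Fin (n - 1)),
      (Metric.closedBall (0 : EuclideanSpace ℝ (Fin (n - 1))) (u / 2)).indicator
        (fun x => ENNReal.ofReal ((u * (u - 2 * ‖x‖)) ^ m)) ((u / 2) • y) =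
      ENNReal.ofReal (u ^ (2 * m)) * (Metric.closedBall
        (0 : EuclideanSpace ℝ (Fin (n - 1))) 1).indicator
          (fun y => ENNReal.ofReal ((1 - ‖y‖) ^ m)) y := by
    intro y
    have hnorm : ‖(u / 2) • y‖ = u / 2 * ‖y‖ := by
      rw [norm_smul, Real.norm_of_nonneg (by positivity)]
    by_cases hy : ‖y‖ ≤ 1
    · rw [indicator_of_mem, indicator_of_mem (by simpa using hy), hnorm,
        ← ENNReal.ofReal_mul (by positivity), show u * (u - 2 * (u / 2 * ‖y‖)) =
          u ^ (2 : ℝ) * (1 - ‖y‖) by rw [Real.rpow_two]; ring,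
        Real.mul_rpow (by positivity) (by linarith), ← Real.rpow_mul hu.le]
      rw [mem_closedBall_zero_iff, hnorm]
      nlinarith
    · rw [indicator_of_notMem, indicator_of_notMem (by simpa using hy), mul_zero]
      rw [mem_closedBall_zero_iff, hnorm]
      push Not at hy ⊢
      nlinarith
  simp_rw [h1]
  rw [lintegral_const_mul' _ _ ENNReal.ofReal_ne_top, lintegral_indicator measurableSet_closedBall,
    lintegral_one_sub_norm_rpow hn hm,
    ENNReal.ofReal_mul (by positivity : (0 : ℝ) ≤ (1 / 2) ^ (n - 1)), ← mul_assoc, ← mul_assoc]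
  congr 1
  rw [← ENNReal.ofReal_mul (by positivity), ← ENNReal.ofReal_mul (by positivity)]
  congr 1
  rw [Real.rpow_add hu, show (n : ℝ) - 1 = ((n - 1 : ℕ) : ℝ) by
      push_cast [show 1 ≤ n by omega]; ring,
    Real.rpow_natCast, div_pow, div_pow, one_pow]
  ring

lemma lintegral_centered_interval {n : ℕ} (hn : 2 ≤ n) {m : ℝ} (hm : 0 ≤ m) {T : ℝ} (hT : 0 < T) :
    ∫⁻ z in causalInterval (0 : MinkPt n) (T, 0), ENNReal.ofReal (minkSq z ^ m) =
      ENNReal.ofReal (diamondConst n m) * ENNReal.ofReal (T ^ (2 * m + n)) := by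
  have hn' : (2 : ℝ) ≤ n := by exact_mod_cast hn
  set F : MinkPt n → ENNReal := (causalInterval (0 : MinkPt n) (T, 0)).indicator
    fun z => ENNReal.ofReal (minkSq z ^ m) with hF
  have hFm : Measurable F :=
    ((measurable_minkSq.pow_const m).ennreal_ofReal).indicator (measurableSet_causalInterval _ _)
  rw [← lintegral_indicator (measurableSet_causalInterval _ _), ← hF, Measure.volume_eq_prod,
    lintegral_prod_symm' _ hFm]
  have hshift : ∀ x : EuclideanSpace ℝ (Fin (n - 1)), ∫⁻ t, F (t, x) = ∫⁻ u, F (u - ‖x‖, x) :=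
    fun x => (lintegral_sub_right_eq_self (fun t => F (t, x)) ‖x‖).symm
  simp_rw [hshift]
  rw [lintegral_lintegral_swap (μ := volume) (ν := volume)
    (f := fun (x : EuclideanSpace ℝ (Fin (n - 1))) (u : ℝ) => F (u - ‖x‖, x))
    (hFm.comp (by fun_prop : Measurable fun p : EuclideanSpace ℝ (Fin (n - 1)) × ℝ =>
      ((p.2 - ‖p.1‖, p.1) : MinkPt n))).aemeasurable]
  have hFeval : ∀ u x, F (u - ‖x‖, x) = (Iic T).indicator (fun u =>
      (Metric.closedBall (0 : EuclideanSpace ℝ (Fin (n - 1))) (u / 2)).indicator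
        (fun x => ENNReal.ofReal ((u * (u - 2 * ‖x‖)) ^ m)) x) u := by
    intro u x
    have hmem : ((u - ‖x‖, x) : MinkPt n) ∈ causalInterval (0 : MinkPt n) (T, 0) ↔
        u ∈ Iic T ∧ x ∈ Metric.closedBall (0 : EuclideanSpace ℝ (Fin (n - 1))) (u / 2) := by
      simp only [causalInterval, causalLE, mem_ofPred_eq, mem_Iic, mem_closedBall_zero_iff,
        Prod.fst_zero, Prod.snd_zero, sub_zero, zero_sub, norm_neg]
      constructor
      · rintro ⟨h1, h2⟩; constructor <;> linarith
      · rintro ⟨h1, h2⟩; constructor <;> linarith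
    have hsq : minkSq ((u - ‖x‖, x) : MinkPt n) = u * (u - 2 * ‖x‖) := by
      simp only [minkSq]; ring
    simp only [hF, indicator, hmem, hsq]
    split_ifs <;> simp_all
  have hinner : ∀ᵐ u : ℝ, ∫⁻ x, F (u - ‖x‖, x) = (Ioc 0 T).indicator
      (fun u => ENNReal.ofReal (u ^ (2 * m + (n - 1)))) u *
      ENNReal.ofReal ((1 / 2) ^ (n - 1) * ballIntegral n m) := by
    filter_upwards [compl_mem_ae_iff.2 (measure_singleton (0 : ℝ))] with u hu
    have hu0 : u ≠ 0 := hu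
    simp_rw [hFeval]
    rcases lt_or_gt_of_ne hu0 with h | h
    · rw [indicator_of_notMem (by simp [h.le]), zero_mul, lintegral_eq_zero_iff']
      · refine Filter.Eventually.of_forall fun x => ?_
        have : x ∉ Metric.closedBall (0 : EuclideanSpace ℝ (Fin (n - 1))) (u / 2) := by
          rw [mem_closedBall_zero_iff]
          have := norm_nonneg x
          linarith
        simp only [indicator_of_notMem this, indicator_apply, ite_self, Pi.zero_apply]
      · have : Measurable fun x => F (u - ‖x‖, x) := hFm.comp (by fun_prop)
        simp_rw [hFeval] at this
        exact this.aemeasurable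
    · by_cases hT' : u ≤ T
      · rw [indicator_of_mem (show u ∈ Ioc 0 T from ⟨h, hT'⟩), ← lintegral_scaled_ball hn hm h,
          ← lintegral_indicator measurableSet_closedBall]
        simp [indicator, hT']
      · simp [indicator, hT']
  rw [lintegral_congr_ae hinner, lintegral_mul_const' _ _ ENNReal.ofReal_ne_top,
    lintegral_indicator measurableSet_Ioc, setLIntegral_rpow_Ioc hT (by linarith),
    ← ENNReal.ofReal_mul (div_nonneg (Real.rpow_nonneg hT.le _) (by linarith)), 
    mul_comm (ENNReal.ofReal (diamondConst n m)), ← ENNReal.ofReal_mul (by positivity)]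
  congr 1
  rw [diamondConst, show 2 * m + ((n : ℝ) - 1) + 1 = 2 * m + n by ring]
  ring

lemma causalLE_trans {n : ℕ} {x y z : MinkPt n} (hxy : causalLE x y) (hyz : causalLE y z) :
    causalLE x z := by
  unfold causalLE at *
  have h := norm_sub_le_norm_sub_add_norm_sub z.2 y.2 x.2
  linarith

lemma causalLE_iff_zero_sub {n : ℕ} {x y : MinkPt n} : causalLE x y ↔ causalLE 0 (y - x) := by
  simp [causalLE]

lemma zero_causalLE_iff {n : ℕ} {x : MinkPt n} : causalLE 0 x ↔ 0 ≤ x.1 ∧ 0 ≤ minkSq x := by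
  simp only [causalLE, minkSq, Prod.fst_zero, Prod.snd_zero, sub_zero, sub_nonneg]
  constructor
  · intro h
    exact ⟨(norm_nonneg _).trans h, pow_le_pow_left₀ (norm_nonneg _) h 2⟩
  · rintro ⟨h0, h⟩
    exact (pow_le_pow_iff_left₀ (norm_nonneg _) h0 two_ne_zero).1 h

/-- The Lorentz involution exchanging `y` and `(τ, 0)`, where `τ > 0` is the proper time of `y`. -/
noncomputable def boost {n : ℕ} (τ : ℝ) (y : MinkPt n) : MinkPt n →ₗ[ℝ] MinkPt n :=
  -LinearMap.id + LinearMap.smulRight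
    ((τ * (τ + y.1))⁻¹ • ((y.1 + τ) • LinearMap.fst ℝ ℝ (EuclideanSpace ℝ (Fin (n - 1))) -
      (innerₛₗ ℝ y.2) ∘ₗ LinearMap.snd ℝ ℝ (EuclideanSpace ℝ (Fin (n - 1)))))
    ((y.1 + τ, y.2) : MinkPt n)

section boost

variable {n : ℕ} {τ : ℝ} {y : MinkPt n}

lemma boost_apply (x : MinkPt n) : boost τ y x =
    -x + ((τ * (τ + y.1))⁻¹ * ((y.1 + τ) * x.1 - inner ℝ y.2 x.2)) •
      ((y.1 + τ, y.2) : MinkPt n) := by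
  simp [boost]

lemma boost_boost (hτ : 0 < τ) (hy : 0 ≤ y.1) (hτy : τ ^ 2 = minkSq y) (x : MinkPt n) :
    boost τ y (boost τ y x) = x := by
  have h : 0 < τ + y.1 := by linarith
  rw [boost_apply (boost τ y x), boost_apply x]
  set l := (τ * (τ + y.1))⁻¹ * ((y.1 + τ) * x.1 - inner ℝ y.2 x.2) with hl
  have h2 : (τ * (τ + y.1))⁻¹ *
      ((y.1 + τ) * (-x + l • ((y.1 + τ, y.2) : MinkPt n)).1 -
        inner ℝ y.2 (-x + l • ((y.1 + τ, y.2) : MinkPt n)).2) = l := by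
    simp only [Prod.fst_add, Prod.fst_neg, Prod.smul_fst, Prod.snd_add, Prod.snd_neg,
      Prod.smul_snd, inner_add_right, inner_neg_right, inner_smul_right,
      real_inner_self_eq_norm_sq, smul_eq_mul]
    have h3 : ‖y.2‖ ^ 2 = y.1 ^ 2 - τ ^ 2 := by rw [hτy, minkSq]; ring
    have h4 : (y.1 + τ) * x.1 - inner ℝ y.2 x.2 = l * (τ * (τ + y.1)) := by
      rw [hl]; field_simp
    rw [h3, inv_mul_eq_iff_eq_mul₀ (by positivity)]
    linear_combination -h4
  rw [h2]
  abel

lemma boost_self (hτ : 0 < τ) (hy : 0 ≤ y.1) (hτy : τ ^ 2 = minkSq y) :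
    boost τ y y = (τ, 0) := by
  have h : 0 < τ + y.1 := by linarith
  have h3 : ‖y.2‖ ^ 2 = y.1 ^ 2 - τ ^ 2 := by rw [hτy, minkSq]; ring
  have h2 : (τ * (τ + y.1))⁻¹ * ((y.1 + τ) * y.1 - inner ℝ y.2 y.2) = 1 := by
    rw [real_inner_self_eq_norm_sq, h3, inv_mul_eq_iff_eq_mul₀ (by positivity)]
    ring
  rw [boost_apply, h2, one_smul]
  ext <;> simp

lemma minkSq_boost (hτ : 0 < τ) (hy : 0 ≤ y.1) (hτy : τ ^ 2 = minkSq y) (x : MinkPt n) :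
    minkSq (boost τ y x) = minkSq x := by
  have h : 0 < τ + y.1 := by linarith
  have h3 : ‖y.2‖ ^ 2 = y.1 ^ 2 - τ ^ 2 := by rw [hτy, minkSq]; ring
  rw [boost_apply]
  set l := (τ * (τ + y.1))⁻¹ * ((y.1 + τ) * x.1 - inner ℝ y.2 x.2) with hl
  have h4 : (y.1 + τ) * x.1 - inner ℝ y.2 x.2 = l * (τ * (τ + y.1)) := by
    rw [hl]; field_simp
  simp only [minkSq, Prod.fst_add, Prod.fst_neg, Prod.smul_fst, Prod.snd_add, Prod.snd_neg,
    Prod.smul_snd, smul_eq_mul, norm_add_sq_real, norm_neg, norm_smul, inner_neg_left,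
    inner_smul_right, mul_pow, Real.norm_eq_abs, sq_abs, h3]
  rw [real_inner_comm] at h4
  linear_combination (-2 * l) * h4

lemma zero_causalLE_boost (hτ : 0 < τ) (hy : causalLE 0 y) (hτy : τ ^ 2 = minkSq y)
    {x : MinkPt n} (hx : causalLE 0 x) : causalLE 0 (boost τ y x) := by
  have hy0 := (zero_causalLE_iff.1 hy).1
  have h : 0 < τ + y.1 := by linarith
  rw [zero_causalLE_iff, minkSq_boost hτ hy0 hτy]
  refine ⟨?_, (zero_causalLE_iff.1 hx).2⟩
  have h1 : (boost τ y x).1 = (x.1 * y.1 - inner ℝ y.2 x.2) / τ := by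
    rw [boost_apply]
    simp only [Prod.fst_add, Prod.fst_neg, Prod.smul_fst, smul_eq_mul]
    field_simp
    ring
  rw [h1]
  refine div_nonneg ?_ hτ.le
  simp only [causalLE, Prod.fst_zero, Prod.snd_zero, sub_zero] at hx hy
  have h2 := real_inner_le_norm y.2 x.2
  have h3 := mul_le_mul hy hx (norm_nonneg _) hy0
  linarith

lemma boost_mem_causalInterval_iff (hτ : 0 < τ) (hy : causalLE 0 y) (hτy : τ ^ 2 = minkSq y)
    {x : MinkPt n} : boost τ y x ∈ causalInterval 0 (τ, 0) ↔ x ∈ causalInterval 0 y := by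
  have hy0 := (zero_causalLE_iff.1 hy).1
  have hiff : ∀ {z}, causalLE 0 (boost τ y z) ↔ causalLE 0 z := fun {z} =>
    ⟨fun h => by simpa only [boost_boost hτ hy0 hτy] using zero_causalLE_boost hτ hy hτy h,
      zero_causalLE_boost hτ hy hτy⟩
  simp only [causalInterval, mem_ofPred_eq]
  rw [hiff, causalLE_iff_zero_sub (x := boost τ y x), ← boost_self hτ hy0 hτy, ← map_sub, hiff,
    ← causalLE_iff_zero_sub]

lemma measurePreserving_boost (hτ : 0 < τ) (hy : 0 ≤ y.1) (hτy : τ ^ 2 = minkSq y) :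
    MeasurePreserving (boost τ y) volume volume := by
  have hcomp : boost τ y ∘ₗ boost τ y = LinearMap.id :=
    LinearMap.ext fun x => boost_boost hτ hy hτy x
  have hdet : LinearMap.det (boost τ y) * LinearMap.det (boost τ y) = 1 := by
    rw [← LinearMap.det_comp, hcomp, LinearMap.det_id]
  have habs : |LinearMap.det (boost τ y)| = 1 := by
    rcases mul_self_eq_one_iff.1 hdet with h | h <;> simp [h]
  refine ⟨(boost τ y).continuous_of_finiteDimensional.measurable, ?_⟩
  have hadd : (volume : Measure (MinkPt n)).IsAddHaarMeasure := by
    rw [Measure.volume_eq_prod]; infer_instance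
  rw [Measure.map_linearMap_addHaar_eq_smul_addHaar _ (left_ne_zero_of_mul_eq_one hdet), abs_inv,
    habs, inv_one, ENNReal.ofReal_one, one_smul]

end boost

lemma diamondConst_eq {n : ℕ} (hn : 2 ≤ n) (m : ℝ) : diamondConst n m =
    (1 / 2) ^ (n - 1) * (((n - 1 : ℕ) : ℝ) *
      volume.real (Metric.ball (0 : EuclideanSpace ℝ (Fin (n - 1))) 1)) *
      Real.Gamma ((n - 1 : ℕ) : ℝ) * Real.Gamma (m + 1) / Real.Gamma (m + n) / (2 * m + n) := by
  rw [diamondConst, ballIntegral, beta, show ((n - 1 : ℕ) : ℝ) + (m + 1) = m + n by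
    push_cast [show 1 ≤ n by omega]; ring]
  ring

lemma diamondConst_nonneg {n : ℕ} (hn : 2 ≤ n) {m : ℝ} (hm : 0 ≤ m) : 0 ≤ diamondConst n m := by
  have h : 0 ≤ beta ((n - 1 : ℕ) : ℝ) (m + 1) :=
    (beta_pos (by exact_mod_cast (by omega : 0 < n - 1)) (by linarith)).le
  unfold diamondConst ballIntegral
  positivity

lemma setLIntegral_interval_of_minkSq_pos {n : ℕ} (hn : 2 ≤ n) {m : ℝ} (hm : 0 ≤ m)
    {y : MinkPt n} (hy : causalLE 0 y) (hpos : 0 < minkSq y) :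
    ∫⁻ z in causalInterval 0 y, ENNReal.ofReal (minkSq z ^ m) =
      ENNReal.ofReal (diamondConst n m) * ENNReal.ofReal (minkSq y ^ (m + n / 2)) := by
  have hτ : 0 < √(minkSq y) := Real.sqrt_pos.2 hpos
  have hτy : √(minkSq y) ^ 2 = minkSq y := Real.sq_sqrt hpos.le
  have hy0 := (zero_causalLE_iff.1 hy).1
  have hmeas := measurableSet_causalInterval (0 : MinkPt n) (√(minkSq y), 0)
  have h := lintegral_centered_interval hn hm hτ
  have hexp : √(minkSq y) ^ (2 * m + n) = minkSq y ^ (m + n / 2) := by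
    rw [Real.sqrt_eq_rpow, ← Real.rpow_mul hpos.le]
    congr 1
    ring
  rw [← lintegral_indicator hmeas, ← (measurePreserving_boost hτ hy0 hτy).lintegral_comp
    (((measurable_minkSq.pow_const m).ennreal_ofReal).indicator hmeas), hexp] at h
  rw [← h, ← lintegral_indicator (measurableSet_causalInterval _ _)]
  refine lintegral_congr fun z => ?_
  have hiff := boost_mem_causalInterval_iff hτ hy hτy (x := z)
  by_cases hz : z ∈ causalInterval 0 y
  · rw [indicator_of_mem hz, indicator_of_mem (hiff.2 hz), minkSq_boost hτ hy0 hτy]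
  · rw [indicator_of_notMem hz, indicator_of_notMem (mt hiff.1 hz)]

lemma setLIntegral_interval_zero {n : ℕ} (hn : 2 ≤ n) {m : ℝ} (hm : 0 ≤ m)
    {y : MinkPt n} (hy : causalLE 0 y) :
    ∫⁻ z in causalInterval 0 y, ENNReal.ofReal (minkSq z ^ m) =
      ENNReal.ofReal (diamondConst n m) * ENNReal.ofReal (minkSq y ^ (m + n / 2)) := by
  obtain ⟨hy0, hy1⟩ := zero_causalLE_iff.1 hy
  rcases hy1.eq_or_lt with hnull | hpos
  swap
  · exact setLIntegral_interval_of_minkSq_pos hn hm hy hpos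
  have hn' : (2 : ℝ) ≤ n := by exact_mod_cast hn
  have hs : 0 < m + (n : ℝ) / 2 := by linarith
  have hright : ENNReal.ofReal (minkSq y ^ (m + (n : ℝ) / 2)) = 0 := by
    rw [← hnull, Real.zero_rpow hs.ne', ENNReal.ofReal_zero]
  have hcont : Continuous fun ε : ℝ => ENNReal.ofReal (diamondConst n m) *
      ENNReal.ofReal (minkSq ((y.1 + ε, y.2) : MinkPt n) ^ (m + (n : ℝ) / 2)) := by
    refine ENNReal.continuous_const_mul ENNReal.ofReal_ne_top |>.comp
      (ENNReal.continuous_ofReal.comp (Continuous.rpow_const ?_ fun _ => Or.inr hs.le))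
    unfold minkSq
    fun_prop
  have hlim := (hcont.tendsto 0).mono_left (nhdsWithin_le_nhds (s := Ioi 0))
  simp only [add_zero] at hlim
  rw [hright, mul_zero] at hlim ⊢

  refine le_antisymm (ge_of_tendsto hlim ?_) zero_le
  filter_upwards [self_mem_nhdsWithin] with ε hε
  have hε' : 0 < ε := hε
  have hle : causalLE y ((y.1 + ε, y.2) : MinkPt n) := by simp [causalLE, hε'.le]
  have hsq : minkSq ((y.1 + ε, y.2) : MinkPt n) = ε * (2 * y.1 + ε) := by
    have h : y.1 ^ 2 - ‖y.2‖ ^ 2 = 0 := hnull.symm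
    simp only [minkSq]
    linear_combination h
  rw [← setLIntegral_interval_of_minkSq_pos hn hm (causalLE_trans hy hle)
    (by rw [hsq]; positivity)]
  exact lintegral_mono_set fun z hz => ⟨hz.1, causalLE_trans hz.2 hle⟩

lemma setLIntegral_causalInterval {n : ℕ} (hn : 2 ≤ n) {m : ℝ} (hm : 0 ≤ m) (p y : MinkPt n) :
    ∫⁻ z in causalInterval p y, ENNReal.ofReal (minkSq (z - p) ^ m) =
      ENNReal.ofReal (diamondConst n m) * {y | causalLE p y}.indicator
        (fun y => ENNReal.ofReal (minkSq (y - p) ^ (m + n / 2))) y := by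
  by_cases hpy : causalLE p y
  · have hadd : (volume : Measure (MinkPt n)).IsAddHaarMeasure := by
      rw [Measure.volume_eq_prod]; infer_instance
    rw [indicator_of_mem (by exact hpy),
      ← setLIntegral_interval_zero hn hm (causalLE_iff_zero_sub.1 hpy),
      ← lintegral_indicator (measurableSet_causalInterval _ _),
      ← lintegral_indicator (measurableSet_causalInterval _ _),
      ← lintegral_sub_right_eq_self (μ := (volume : Measure (MinkPt n)))
        ((causalInterval 0 (y - p)).indicator fun z => ENNReal.ofReal (minkSq z ^ m)) p]
    refine lintegral_congr fun z => ?_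
    have hmem : z ∈ causalInterval p y ↔ z - p ∈ causalInterval 0 (y - p) := by
      simp [causalInterval, causalLE]
    by_cases hz : z ∈ causalInterval p y
    · rw [indicator_of_mem hz, indicator_of_mem (hmem.1 hz)]
    · rw [indicator_of_notMem hz, indicator_of_notMem (mt hmem.2 hz)]
  · have hempty : causalInterval p y = ∅ :=
      eq_empty_of_forall_notMem fun z hz => hpy (causalLE_trans hz.1 hz.2)
    rw [indicator_of_notMem (by exact hpy), hempty]
    simp

/-- The set of chains of `k + 1` points between `p` and `y`. -/
def chainSet {n : ℕ} (p : MinkPt n) (k : ℕ) (y : MinkPt n) : Set (Fin (k + 1) → MinkPt n) :=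
  {x | causalLE p (x 0) ∧ causalLE (x (Fin.last k)) y ∧
    ∀ i : Fin k, causalLE (x i.castSucc) (x i.succ)}

lemma measurableSet_setOf_mem_chainSet {α : Type*} [MeasurableSpace α] {n k : ℕ} (p : MinkPt n)
    {f : α → Fin (k + 1) → MinkPt n} {g : α → MinkPt n} (hf : Measurable f) (hg : Measurable g) :
    MeasurableSet {a | f a ∈ chainSet p k (g a)} := by
  have h : MeasurableSet {a | ∀ i : Fin k, causalLE (f a i.castSucc) (f a i.succ)} := by
    rw [ofPred_forall]
    exact MeasurableSet.iInter fun i => measurableSet_setOf_causalLE (by fun_prop) (by fun_prop)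
  exact (measurableSet_setOf_causalLE measurable_const (by fun_prop)).inter
    ((measurableSet_setOf_causalLE (by fun_prop) hg).inter h)

lemma volume_chainSet {n : ℕ} (hn : 2 ≤ n) (p : MinkPt n) (k : ℕ) (y : MinkPt n) :
    volume (chainSet p k y) =
      (∏ j ∈ Finset.range (k + 1), ENNReal.ofReal (diamondConst n (j * n / 2))) *
        {y | causalLE p y}.indicator
          (fun y => ENNReal.ofReal (minkSq (y - p) ^ (((k + 1 : ℕ) : ℝ) * n / 2))) y := by
  induction k generalizing y with
  | zero =>
    have hpre : chainSet p 0 y =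
        MeasurableEquiv.funUnique (Fin 1) (MinkPt n) ⁻¹' causalInterval p y := by
      ext x
      simp [chainSet, causalInterval]
    rw [hpre]
    refine ((volume_preserving_funUnique (Fin 1) (MinkPt n)).measure_preimage
      (measurableSet_causalInterval p y).nullMeasurableSet).trans ?_
    have h := setLIntegral_causalInterval hn le_rfl p y
    simp only [Real.rpow_zero, ENNReal.ofReal_one, setLIntegral_one] at h
    rw [h]
    simp
  | succ k ih =>
    set S : Set (MinkPt n × (Fin (k + 1) → MinkPt n)) :=
      {a | causalLE a.1 y ∧ a.2 ∈ chainSet p k a.1} with hS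
    have hSm : MeasurableSet S :=
      (measurableSet_setOf_causalLE measurable_fst measurable_const).inter
        (measurableSet_setOf_mem_chainSet p measurable_snd measurable_fst)
    have hpre : chainSet p (k + 1) y = MeasurableEquiv.piFinSuccAbove
        (fun _ : Fin (k + 2) => MinkPt n) (Fin.last (k + 1)) ⁻¹' S := by
      ext x
      simp only [chainSet, hS, mem_preimage, mem_ofPred_eq, MeasurableEquiv.piFinSuccAbove_apply,
        Fin.insertNthEquiv, Equiv.coe_fn_symm_mk, Fin.removeNth, Fin.succAbove_last,
        Fin.forall_fin_succ', Fin.castSucc_zero, Fin.succ_last, Fin.succ_castSucc]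
      tauto
    rw [hpre, (volume_preserving_piFinSuccAbove (fun _ : Fin (k + 2) => MinkPt n)
      (Fin.last (k + 1))).measure_preimage hSm.nullMeasurableSet, Measure.volume_eq_prod,
      Measure.prod_apply hSm]
    have hm : (0 : ℝ) ≤ ((k + 1 : ℕ) : ℝ) * n / 2 := by positivity
    have hslice : ∀ x, volume (Prod.mk x ⁻¹' S) =
        (∏ j ∈ Finset.range (k + 1), ENNReal.ofReal (diamondConst n (j * n / 2))) *
        (causalInterval p y).indicator
          (fun z => ENNReal.ofReal (minkSq (z - p) ^ (((k + 1 : ℕ) : ℝ) * n / 2))) x := by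
      intro x
      by_cases hxy : causalLE x y
      · have h1 : Prod.mk x ⁻¹' S = chainSet p k x := by ext; simp [hS, hxy]
        rw [h1, ih]
        by_cases hpx : causalLE p x <;> simp [indicator, causalInterval, hxy, hpx]
      · have h1 : Prod.mk x ⁻¹' S = ∅ := by ext; simp [hS, hxy]
        rw [h1]
        simp [indicator, causalInterval, hxy]
    simp_rw [hslice]
    rw [lintegral_const_mul' _ _ (ENNReal.prod_ne_top fun _ _ => ENNReal.ofReal_ne_top),
      lintegral_indicator (measurableSet_causalInterval p y), setLIntegral_causalInterval hn hm,
      Finset.prod_range_succ _ (k + 1), mul_assoc,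
      show ((k + 1 : ℕ) : ℝ) * n / 2 + n / 2 = ((k + 1 + 1 : ℕ) : ℝ) * n / 2 by push_cast; ring]

lemma chi_one {n : ℕ} (hn : 2 ≤ n) : chi n 1 = 1 := by
  have hn' : (0 : ℝ) < n := by exact_mod_cast (by omega : 0 < n)
  have h1 := (Real.Gamma_pos_of_pos hn').ne'
  have h2 := (Real.Gamma_pos_of_pos (half_pos hn')).ne'
  simp only [chi, Nat.cast_one, Nat.sub_self, pow_zero, one_mul, div_one, one_add_one_eq_two]
  rw [mul_div_cancel_left₀ _ two_ne_zero]
  field_simp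

lemma chi_succ_mul_diamondConst {n : ℕ} (hn : 2 ≤ n) {k : ℕ} (hk : 0 < k) :
    chi n k * diamondConst n (k * n / 2) = chi n (k + 1) * diamondConst n 0 := by
  have hn' : (0 : ℝ) < n := by exact_mod_cast (by omega : 0 < n)
  have hk' : (0 : ℝ) < k := by exact_mod_cast hk
  obtain ⟨l, rfl⟩ : ∃ l, k = l + 1 := ⟨k - 1, by omega⟩
  rw [diamondConst_eq hn, diamondConst_eq hn, chi, chi]
  set κ : ℝ := ((l + 1 : ℕ) : ℝ)
  have e1 : ((l + 1 + 1 : ℕ) : ℝ) = κ + 1 := by simp [κ]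
  have e2 : (κ + 1 + 1) * (n : ℝ) / 2 = κ * n / 2 + n := by ring
  have hg : Real.Gamma (κ * n / 2 + 1) = κ * n / 2 * Real.Gamma (κ * n / 2) :=
    Real.Gamma_add_one (by positivity)
  have hgn : Real.Gamma ((n : ℝ) + 1) = n * Real.Gamma n := Real.Gamma_add_one hn'.ne'
  rw [e1, e2, hg, hgn, zero_add, zero_add, Real.Gamma_one]
  have h1 := (Real.Gamma_pos_of_pos hn').ne'
  have h2 := (Real.Gamma_pos_of_pos (half_pos hn')).ne'
  have h3 := (Real.Gamma_pos_of_pos (show 0 < κ * n / 2 by positivity)).ne'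
  have h4 := (Real.Gamma_pos_of_pos (show 0 < κ * n / 2 + n by positivity)).ne'
  have h5 := (Real.Gamma_pos_of_pos (show 0 < (κ + 1) * n / 2 by positivity)).ne'
  simp only [Nat.add_sub_cancel, pow_succ]
  rw [show 2 * (κ * n / 2) + (n : ℝ) = (κ + 1) * n by ring, mul_zero, zero_add]
  generalize Real.Gamma (κ * n / 2 + n) = G4 at *
  generalize Real.Gamma ((κ + 1) * n / 2) = G5 at *
  generalize Real.Gamma (κ * n / 2) = G3 at *
  field_simp

lemma prod_diamondConst {n : ℕ} (hn : 2 ≤ n) (k : ℕ) :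
    ∏ j ∈ Finset.range (k + 1), diamondConst n (j * n / 2) =
      chi n (k + 1) * diamondConst n 0 ^ (k + 1) := by
  induction k with
  | zero => simp [chi_one hn]
  | succ k ih =>
    rw [Finset.prod_range_succ, ih, pow_succ _ (k + 1)]
    linear_combination diamondConst n 0 ^ (k + 1) * chi_succ_mul_diamondConst hn k.succ_pos

/-- Meyer's k-chain formula in flat spacetime: the Lebesgue measure (on `(ℝ^n)^k`) of the
set of k-chains `{(x₁,…,x_k) : p ⪯ x₁ ⪯ ⋯ ⪯ x_k ⪯ q}` equals `χ_k · V₀^k`, where `V₀` is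
the Lebesgue volume of `I[p,q]`.  In particular `χ₁ = 1`. -/
theorem stmt8 (n k : ℕ) (hn : 2 ≤ n) (hk : 0 < k) (T : ℝ) (hT : 0 < T) :
    (volume {x : Fin k → MinkPt n |
        causalLE (pDiam n T) (x ⟨0, hk⟩) ∧
        causalLE (x ⟨k - 1, Nat.sub_lt hk Nat.one_pos⟩) (qDiam n T) ∧
        ∀ i : ℕ, ∀ h : i + 1 < k,
          causalLE (x ⟨i, Nat.lt_of_succ_lt h⟩) (x ⟨i + 1, h⟩)}).toReal =
      chi n k * ((volume (diamond n T)).toReal) ^ k ∧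
    chi n 1 = 1 := by
  refine ⟨?_, chi_one hn⟩
  obtain ⟨k, rfl⟩ : ∃ l, k = l + 1 := ⟨k - 1, by omega⟩
  have hset : {x : Fin (k + 1) → MinkPt n |
        causalLE (pDiam n T) (x ⟨0, hk⟩) ∧
        causalLE (x ⟨k + 1 - 1, Nat.sub_lt hk Nat.one_pos⟩) (qDiam n T) ∧
        ∀ i : ℕ, ∀ h : i + 1 < k + 1,
          causalLE (x ⟨i, Nat.lt_of_succ_lt h⟩) (x ⟨i + 1, h⟩)} =
      chainSet (pDiam n T) k (qDiam n T) := by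
    ext x
    exact and_congr Iff.rfl (and_congr Iff.rfl
      ⟨fun h i => h i (Nat.succ_lt_succ i.2), fun h i hi => h ⟨i, Nat.lt_of_succ_lt_succ hi⟩⟩)
  have hpq : causalLE (pDiam n T) (qDiam n T) := by
    simp only [causalLE, pDiam, qDiam, sub_zero, norm_zero]
    linarith
  have hsq : minkSq (qDiam n T - pDiam n T) = T ^ 2 := by
    simp only [minkSq, pDiam, qDiam, Prod.mk_sub_mk, sub_zero, norm_zero]
    ring
  have hdiam : volume (diamond n T) =
      ENNReal.ofReal (diamondConst n 0) * ENNReal.ofReal ((T ^ 2) ^ ((n : ℝ) / 2)) := by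
    have h := setLIntegral_causalInterval hn le_rfl (pDiam n T) (qDiam n T)
    simp only [Real.rpow_zero, ENNReal.ofReal_one, setLIntegral_one] at h
    rw [indicator_of_mem (by exact hpq), hsq, zero_add] at h
    exact h
  have hc := diamondConst_nonneg hn le_rfl
  have hp : 0 ≤ chi n (k + 1) * diamondConst n 0 ^ (k + 1) := by
    rw [← prod_diamondConst hn]
    exact Finset.prod_nonneg fun j _ => diamondConst_nonneg hn (by positivity)
  have hTk : 0 ≤ (T ^ 2) ^ (((k + 1 : ℕ) : ℝ) * n / 2) := by positivity
  have hT' : 0 ≤ (T ^ 2) ^ ((n : ℝ) / 2) := by positivity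
  rw [hset, volume_chainSet hn, indicator_of_mem (by exact hpq), hsq, hdiam,
    ← ENNReal.ofReal_prod_of_nonneg fun j _ => diamondConst_nonneg hn (by positivity),
    prod_diamondConst hn, ENNReal.toReal_mul, ENNReal.toReal_mul, ENNReal.toReal_ofReal hc,
    ENNReal.toReal_ofReal hT', ENNReal.toReal_ofReal hp, ENNReal.toReal_ofReal hTk,
    mul_pow, mul_assoc, ← Real.rpow_natCast ((T ^ 2) ^ ((n : ℝ) / 2)),
    ← Real.rpow_mul (by positivity)]
  congr 3
  ring
end
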